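/- arXiv:2002.10863 — 6 statements merged into one kernel-verified Lean document; each statement's English description precedes it below -/
import Mathlib

section
/- Let μ be a finite Borel measure on ℝ² equipped with the sup metric, let x ∈ ℝ², and let d > 1, w > 1 and ε > 0 be such that δ := (d−1)(w−1) − ε(w+1) > 0. Suppose there exist constants c₁, c₂ > 0 and r₀ > 0 such that μ(B_∞(y,s)) ≤ c₁ s^{d−ε} for every y ∈ ℝ² and every 0 < s ≤ r₀, and μ(B_∞(x,r)) ≥ c₂ r^{d+ε} for every 0 < r ≤ r₀. Then there exist C > 0 and r₁ > 0 such that μ(B_∞(x, r + r^w) \ B_∞(x, r)) ≤ C r^δ μ(B_∞(x, r)) for all 0 < r < r₁. -/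
open MeasureTheory Metric

lemma aux_union (μ : Measure (ℝ × ℝ)) (s : ℝ) (B : ENNReal) (N : ℕ) (f : ℕ → ℝ × ℝ)
    (h : ∀ y, μ (ball y s) ≤ B) : μ (⋃ k ∈ Finset.range N, ball (f k) s) ≤ N * B := by
  refine (measure_biUnion_finset_le _ _).trans ?_
  refine (Finset.sum_le_sum (fun k _ => h (f k))).trans ?_
  simp

lemma aux_floor (r s v : ℝ) (hs : 0 < s) (hsr : s ≤ r) (h : |v| < r + s) :
    ∃ k ∈ Finset.range ⌈4 * r / s⌉₊, |v - (-(r + s) + k * s)| < s := by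
  obtain ⟨h1, h2⟩ := abs_lt.1 h
  have h0 : 0 ≤ (v + r + s) / s := div_nonneg (by linarith) hs.le
  have hf := Nat.floor_le h0
  have hl := Nat.lt_floor_add_one ((v + r + s) / s)
  rw [le_div_iff₀ hs] at hf
  rw [div_lt_iff₀ hs] at hl
  refine ⟨⌊(v + r + s) / s⌋₊, ?_, ?_⟩
  · rw [Finset.mem_range, Nat.lt_ceil, lt_div_iff₀ hs]
    linarith
  · rw [abs_lt]
    constructor <;> nlinarith

lemma aux_sign (r s u : ℝ) (h1 : r ≤ |u|) (h2 : |u| < r + s) :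
    |u - r| < s ∨ |u + r| < s := by
  rcases abs_cases u with ⟨h, _⟩ | ⟨h, _⟩
  · left; rw [abs_lt]; constructor <;> linarith
  · right; rw [abs_lt]; constructor <;> linarith

lemma aux_cover (x : ℝ × ℝ) (r s : ℝ) (hs : 0 < s) (hsr : s ≤ r) :
    ball x (r + s) \ ball x r ⊆
      ((⋃ k ∈ Finset.range ⌈4 * r / s⌉₊, ball (x.1 + r, x.2 + (-(r + s) + (k : ℕ) * s)) s) ∪
       (⋃ k ∈ Finset.range ⌈4 * r / s⌉₊, ball (x.1 - r, x.2 + (-(r + s) + (k : ℕ) * s)) s)) ∪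
      ((⋃ k ∈ Finset.range ⌈4 * r / s⌉₊, ball (x.1 + (-(r + s) + (k : ℕ) * s), x.2 + r) s) ∪
       (⋃ k ∈ Finset.range ⌈4 * r / s⌉₊, ball (x.1 + (-(r + s) + (k : ℕ) * s), x.2 - r) s)) := by
  rintro ⟨p, q⟩ ⟨h1, h2⟩
  rw [mem_ball, Prod.dist_eq, max_lt_iff, Real.dist_eq, Real.dist_eq] at h1
  rw [mem_ball, Prod.dist_eq, not_lt, le_max_iff, Real.dist_eq, Real.dist_eq] at h2
  simp only at h1 h2
  simp only [Set.mem_union, Set.mem_iUnion, mem_ball, Prod.dist_eq, max_lt_iff, Real.dist_eq,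
    exists_prop]
  rcases h2 with h2 | h2
  · left
    obtain ⟨k, hk, hk'⟩ := aux_floor r s _ hs hsr h1.2
    rcases aux_sign r s _ h2 h1.1 with h | h
    · left; exact ⟨k, hk, by rwa [← sub_sub], by rwa [← sub_sub]⟩
    · right; exact ⟨k, hk, by rwa [← sub_add], by rwa [← sub_sub]⟩
  · right
    obtain ⟨k, hk, hk'⟩ := aux_floor r s _ hs hsr h1.1
    rcases aux_sign r s _ h2 h1.2 with h | h
    · left; exact ⟨k, hk, by rwa [← sub_sub], by rwa [← sub_sub]⟩
    · right; exact ⟨k, hk, by rwa [← sub_sub], by rwa [← sub_add]⟩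

/-- Annulus-type condition for the `ℓ^∞` metric on `ℝ²` (Lemma, case II):
if `μ` satisfies an upper `d - ε` regularity bound at all points and a lower
`d + ε` bound at `x`, then the measure of a thin annulus around `x` is small
compared with the measure of the ball, with exponent
`δ = (d-1)(w-1) - ε(w+1)`. -/
theorem stmt_0 (μ : Measure (ℝ × ℝ)) [IsFiniteMeasure μ] (x : ℝ × ℝ)
    (d w ε : ℝ) (hd : 1 < d) (hw : 1 < w) (hε : 0 < ε)
    (hδ : 0 < (d - 1) * (w - 1) - ε * (w + 1))
    (c₁ c₂ r₀ : ℝ) (hc₁ : 0 < c₁) (hc₂ : 0 < c₂) (hr₀ : 0 < r₀)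
    (hub : ∀ (y : ℝ × ℝ) (s : ℝ), 0 < s → s ≤ r₀ →
      μ (ball y s) ≤ ENNReal.ofReal (c₁ * s ^ (d - ε)))
    (hlb : ∀ r : ℝ, 0 < r → r ≤ r₀ →
      ENNReal.ofReal (c₂ * r ^ (d + ε)) ≤ μ (ball x r)) :
    ∃ C > (0:ℝ), ∃ r₁ > (0:ℝ), ∀ r : ℝ, 0 < r → r < r₁ →
      μ (ball x (r + r ^ w) \ ball x r) ≤
        ENNReal.ofReal (C * r ^ ((d - 1) * (w - 1) - ε * (w + 1))) * μ (ball x r) := by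
  refine ⟨20 * c₁ / c₂, by positivity, min 1 r₀, by positivity, fun r hr hr1 => ?_⟩
  obtain ⟨hr1, hrr⟩ := lt_min_iff.1 hr1
  have hs : 0 < r ^ w := Real.rpow_pos_of_pos hr w
  have hsr : r ^ w ≤ r := by
    simpa using Real.rpow_le_rpow_of_exponent_ge hr hr1.le hw.le
  have hB := fun y => hub y (r ^ w) hs (hsr.trans hrr.le)
  have hpos : 0 < (r ^ w) ^ (d - ε) := Real.rpow_pos_of_pos hs _
  refine (measure_mono (aux_cover x r (r ^ w) hs hsr)).trans ?_
  refine (measure_union_le _ _).trans ?_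
  refine (add_le_add (measure_union_le _ _) (measure_union_le _ _)).trans ?_
  refine (add_le_add (add_le_add (aux_union μ _ _ _ _ hB) (aux_union μ _ _ _ _ hB))
    (add_le_add (aux_union μ _ _ _ _ hB) (aux_union μ _ _ _ _ hB))).trans ?_
  refine le_trans ?_ (mul_le_mul_right (hlb r hr hrr.le) _)
  have hp2 : 0 < r ^ ((d - 1) * (w - 1) - ε * (w + 1)) := Real.rpow_pos_of_pos hr _
  rw [← ENNReal.ofReal_natCast, ← ENNReal.ofReal_mul (by positivity),
    ← ENNReal.ofReal_mul (by positivity), ← ENNReal.ofReal_add (by positivity) (by positivity),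
    ← ENNReal.ofReal_add (by positivity) (by positivity)]
  apply ENNReal.ofReal_le_ofReal
  have hN : (⌈4 * r / r ^ w⌉₊ : ℝ) ≤ 5 * (r / r ^ w) := by
    have h1 := (Nat.ceil_lt_add_one (a := 4 * r / r ^ w) (by positivity)).le
    have h2 : 1 ≤ r / r ^ w := by rwa [one_le_div hs]
    rw [mul_div_assoc] at h1 ⊢
    linarith
  have key : r ^ ((d - 1) * (w - 1) - ε * (w + 1)) * r ^ (d + ε)
      = (r / r ^ w) * (r ^ w) ^ (d - ε) := by
    rw [← Real.rpow_add hr, ← Real.rpow_mul hr.le]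
    nth_rewrite 2 [← Real.rpow_one r]
    rw [← Real.rpow_sub hr, ← Real.rpow_add hr]
    congr 1; ring
  have h3 := mul_le_mul_of_nonneg_right hN (by positivity : 0 ≤ c₁ * (r ^ w) ^ (d - ε))
  calc _ = 4 * (⌈4 * r / r ^ w⌉₊ * (c₁ * (r ^ w) ^ (d - ε))) := by ring
    _ ≤ 4 * (5 * (r / r ^ w) * (c₁ * (r ^ w) ^ (d - ε))) := by linarith
    _ = 20 * c₁ * ((r / r ^ w) * (r ^ w) ^ (d - ε)) := by ring
    _ = _ := by rw [← key]; field_simp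
end

section
/- For every w > 1 there exist C > 0 and r₀ > 0 such that for all 0 < r < r₀ and all a ∈ ℝ, the one-dimensional Lebesgue measure of the set {y ∈ ℝ : r² ≤ a² + y² ≤ (r + r^w)²} is at most C r^{(w+1)/2}. -/
/-- Geometric estimate for the Euclidean annulus: the intersection of the
annulus `B(x, r + r^w) \ B(x, r)` in `ℝ²` with a vertical line at horizontal
distance `a` from the center has one-dimensional Lebesgue measure
`O(r^{(w+1)/2})`. -/
theorem stmt_2 (w : ℝ) (hw : 1 < w) :
    ∃ C > (0:ℝ), ∃ r₀ > (0:ℝ), ∀ r : ℝ, 0 < r → r < r₀ → ∀ a : ℝ,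
      MeasureTheory.volume {y : ℝ | r ^ 2 ≤ a ^ 2 + y ^ 2 ∧ a ^ 2 + y ^ 2 ≤ (r + r ^ w) ^ 2}
        ≤ ENNReal.ofReal (C * r ^ ((w + 1) / 2)) := by
  refine ⟨4, by norm_num, 1, one_pos, ?_⟩
  intro r hr hr1 a
  have hs0 : 0 < r ^ ((w + 1) / 2) := Real.rpow_pos_of_pos hr _
  have hs2 : (r ^ ((w + 1) / 2)) ^ 2 = r ^ w * r := by
    rw [← Real.rpow_natCast, ← Real.rpow_mul hr.le, ← Real.rpow_add_one hr.ne']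
    congr 1
    push_cast
    ring
  have ht0 : 0 < r ^ w := Real.rpow_pos_of_pos hr _
  have htr : r ^ w ≤ r := by
    have := Real.rpow_le_rpow_of_exponent_ge hr hr1.le hw.le
    rwa [Real.rpow_one] at this
  generalize r ^ ((w + 1) / 2) = s at *
  generalize r ^ w = t at *
  obtain ⟨A, hA⟩ : ∃ A, A = max 0 (r ^ 2 - a ^ 2) := ⟨_, rfl⟩
  have hA0 : 0 ≤ A := hA ▸ le_max_left _ _
  have hA1 : r ^ 2 - a ^ 2 ≤ A := hA ▸ le_max_right _ _
  have hq0 := Real.sqrt_nonneg A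
  have hq2 := Real.sq_sqrt hA0
  have hsub : {y : ℝ | r ^ 2 ≤ a ^ 2 + y ^ 2 ∧ a ^ 2 + y ^ 2 ≤ (r + t) ^ 2} ⊆
      Set.Icc (√A) (√A + 2 * s) ∪ Set.Icc (-√A - 2 * s) (-√A) := by
    rintro y ⟨h1, h2⟩
    have hAy : A ≤ y ^ 2 := by
      rw [hA]
      exact max_le (sq_nonneg y) (by linarith)
    have hlo : √A ≤ |y| :=
      (abs_le_of_sq_le_sq' (by rw [hq2, sq_abs]; exact hAy) (abs_nonneg y)).2
    have hhi : |y| ≤ √A + 2 * s := by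
      refine (abs_le_of_sq_le_sq' ?_ (by positivity)).2
      rw [sq_abs]
      nlinarith [mul_nonneg hq0 hs0.le, mul_le_mul_of_nonneg_left htr ht0.le]
    rcases abs_cases y with ⟨h, _⟩ | ⟨h, _⟩ <;> rw [h] at hlo hhi
    · exact Or.inl ⟨hlo, hhi⟩
    · exact Or.inr ⟨by linarith, by linarith⟩
  refine (MeasureTheory.measure_mono hsub).trans ((MeasureTheory.measure_union_le _ _).trans ?_)
  rw [Real.volume_Icc, Real.volume_Icc, ← ENNReal.ofReal_add (by linarith) (by linarith)]
  apply ENNReal.ofReal_le_ofReal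
  linarith
end

section
/- Let T be the standard baker's map, T(x,y) = (x/2, 2y) if y < 1/2 and T(x,y) = ((x+1)/2, 2y−1) if y ≥ 1/2, and let z ∈ (0,1)² be a point whose coordinates are both non-dyadic and which satisfies T^p z = z for some p ≥ 1. Then there exists r₀ > 0 such that for all 0 < r < r₀, Leb( B_∞(z, r) ∩ T^{−p}(B_∞(z, r)) ) = 2^{−p} · Leb( B_∞(z, r) ). In particular lim_{r→0} Leb(B_∞(z,r) ∩ T^{−p}B_∞(z,r)) / Leb(B_∞(z,r)) = 2^{−p}, so the extremal index at z equals θ = 1 − 2^{−p}. -/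
open MeasureTheory Filter
open scoped Classical ENNReal Topology

/-- A real number is non-dyadic if it is not of the form `m / 2^ℓ`. -/
def Nondyadic (x : ℝ) : Prop := ∀ (m : ℤ) (l : ℕ), x ≠ (m : ℝ) / 2 ^ l

/-- The standard baker's map: `T(x,y) = (x/2, 2y)` if `y < 1/2` and
`T(x,y) = ((x+1)/2, 2y-1)` if `y ≥ 1/2`. -/
noncomputable def bakerMap (p : ℝ × ℝ) : ℝ × ℝ :=
  if p.2 < 1 / 2 then (p.1 / 2, 2 * p.2) else ((p.1 + 1) / 2, 2 * p.2 - 1)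

theorem baker_iter_local (n : ℕ) : ∀ z : ℝ × ℝ, Nondyadic z.2 →
    ∃ δ > (0:ℝ), ∀ w : ℝ × ℝ, |w.2 - z.2| < δ →
      (bakerMap^[n] w).1 - (bakerMap^[n] z).1 = (w.1 - z.1) / 2 ^ n ∧
      (bakerMap^[n] w).2 - (bakerMap^[n] z).2 = 2 ^ n * (w.2 - z.2) := by
  induction n with
  | zero => intro z _; exact ⟨1, one_pos, fun w _ => by simp⟩
  | succ n ih =>
    intro z hz
    have hne : z.2 ≠ 1 / 2 := by simpa using hz 1 1
    have hT : Nondyadic (bakerMap z).2 := by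
      intro m l h
      unfold bakerMap at h
      split_ifs at h
      · apply hz m (l + 1)
        simp only at h
        rw [pow_succ, ← div_div, ← h]; ring
      · apply hz (m + 2 ^ l) (l + 1)
        simp only at h
        have h2 : (2:ℝ) ^ l ≠ 0 := by positivity
        push_cast
        rw [pow_succ, ← div_div, add_div, ← h, div_self h2]; ring
    obtain ⟨δ, hδ, H⟩ := ih _ hT
    refine ⟨min (δ / 2) |z.2 - 1 / 2|, lt_min (by linarith) (abs_pos.2 (sub_ne_zero.2 hne)), ?_⟩
    intro w hw
    obtain ⟨hw1, hw2⟩ := lt_min_iff.1 hw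
    have key : (bakerMap w).1 - (bakerMap z).1 = (w.1 - z.1) / 2 ∧
        (bakerMap w).2 - (bakerMap z).2 = 2 * (w.2 - z.2) := by
      rw [abs_lt] at hw2
      rcases lt_or_ge z.2 (1 / 2) with h | h
      · rw [abs_of_neg (by linarith)] at hw2
        have h' : w.2 < 1 / 2 := by linarith
        simp only [bakerMap, if_pos h, if_pos h']
        constructor <;> ring
      · rw [abs_of_nonneg (by linarith)] at hw2
        have h' : ¬ w.2 < 1 / 2 := by linarith
        simp only [bakerMap, if_neg (not_lt.2 h), if_neg h']
        constructor <;> ring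
    have := H (bakerMap w) (by
      rw [key.2, abs_mul, abs_two]; linarith)
    rw [Function.iterate_succ_apply, Function.iterate_succ_apply, this.1, this.2, key.1, key.2]
    constructor
    · rw [pow_succ, div_div, mul_comm (2:ℝ)]
    · ring

/-- At a periodic point `z ∈ (0,1)²` of period `p` with non-dyadic coordinates,
for all sufficiently small `r` one has
`Leb(B_∞(z,r) ∩ T^{-p} B_∞(z,r)) = 2^{-p} · Leb(B_∞(z,r))`, and in particular
the ratio tends to `2^{-p}` as `r → 0`; the extremal index at `z` is thus
`θ = 1 - 2^{-p}`. Here `Metric.ball` on `ℝ × ℝ` is the open ball for the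
`ℓ^∞` (sup) metric. -/
theorem stmt_10 (z : ℝ × ℝ) (hz : z ∈ Set.Ioo (0:ℝ) 1 ×ˢ Set.Ioo (0:ℝ) 1)
    (hx : Nondyadic z.1) (hy : Nondyadic z.2) (p : ℕ) (hp : 1 ≤ p)
    (hper : bakerMap^[p] z = z) :
    (∃ r₀ > (0:ℝ), ∀ r : ℝ, 0 < r → r < r₀ →
      volume (Metric.ball z r ∩ bakerMap^[p] ⁻¹' Metric.ball z r) =
        (2 : ℝ≥0∞)⁻¹ ^ p * volume (Metric.ball z r)) ∧
    Tendsto (fun r : ℝ =>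
        volume (Metric.ball z r ∩ bakerMap^[p] ⁻¹' Metric.ball z r) /
          volume (Metric.ball z r))
      (𝓝[>] 0) (𝓝 ((2 : ℝ≥0∞)⁻¹ ^ p)) := by
  have A : ∃ r₀ > (0:ℝ), ∀ r : ℝ, 0 < r → r < r₀ →
      volume (Metric.ball z r ∩ bakerMap^[p] ⁻¹' Metric.ball z r) =
        (2 : ℝ≥0∞)⁻¹ ^ p * volume (Metric.ball z r) := by
    obtain ⟨δ, hδ, H⟩ := baker_iter_local p z hy
    refine ⟨δ, hδ, fun r hr hrδ => ?_⟩
    have h1 : (1:ℝ) ≤ 2 ^ p := one_le_pow₀ (by norm_num)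
    have h0 : (0:ℝ) < 2 ^ p := by positivity
    have hset : Metric.ball z r ∩ bakerMap^[p] ⁻¹' Metric.ball z r =
        Metric.ball z.1 r ×ˢ Metric.ball z.2 (r / 2 ^ p) := by
      ext w
      simp only [Set.mem_inter_iff, Set.mem_preimage, Metric.mem_ball, Prod.dist_eq, max_lt_iff,
        Set.mem_prod, Real.dist_eq]
      rw [lt_div_iff₀ h0]
      constructor
      · rintro ⟨⟨a, b⟩, c, d⟩
        have := (H w (b.trans hrδ)).2
        rw [hper] at this
        rw [this, abs_mul, abs_of_pos h0] at d
        exact ⟨a, by linarith⟩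
      · rintro ⟨a, b⟩
        have b' : |w.2 - z.2| < r := by nlinarith [abs_nonneg (w.2 - z.2)]
        have := H w (b'.trans hrδ)
        rw [hper] at this
        rw [this.1, this.2, abs_mul, abs_div, abs_of_pos h0]
        refine ⟨⟨a, b'⟩, ?_, by linarith⟩
        exact (div_le_self (abs_nonneg _) h1).trans_lt a
    have hb : Metric.ball z r = Metric.ball z.1 r ×ˢ Metric.ball z.2 r :=
      (ball_prod_same z.1 z.2 r).symm
    have h2 : (2 : ℝ≥0∞)⁻¹ ^ p = ENNReal.ofReal (1 / 2 ^ p) := by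
      rw [one_div, ← inv_pow, ENNReal.ofReal_pow (by norm_num),
        ENNReal.ofReal_inv_of_pos (by norm_num), ENNReal.ofReal_ofNat]
    rw [hset, hb, Measure.volume_eq_prod, Measure.prod_prod, Measure.prod_prod,
      Real.volume_ball, Real.volume_ball, Real.volume_ball, h2,
      ← ENNReal.ofReal_mul (by positivity), ← ENNReal.ofReal_mul (by positivity),
      ← ENNReal.ofReal_mul (by positivity)]
    congr 1
    ring
  refine ⟨A, ?_⟩
  obtain ⟨r₀, hr₀, H⟩ := A
  refine tendsto_const_nhds.congr' ?_
  filter_upwards [Ioo_mem_nhdsGT hr₀] with r hr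
  rw [H r hr.1 hr.2, ENNReal.mul_div_cancel_right]
  · exact (Metric.measure_ball_pos volume z hr.1).ne'
  · exact measure_ball_lt_top.ne
end

section
/- Let T be the standard baker's map, T(x,y) = (x/2, 2y) if y < 1/2 and T(x,y) = ((x+1)/2, 2y−1) if y ≥ 1/2, and let z ∈ (0,1)² be a periodic point of minimal period p whose coordinates are both non-dyadic. Then: (i) for every k ≥ 0 there exists r_k > 0 such that the ratio Leb( ⋂_{i=0}^{k} T^{−ip} B(z, r) ) / Leb( B(z, r) ) is equal to a constant â_{k+1} (independent of r) for all 0 < r < r_k, where B(z,r) is the open Euclidean ball; and (ii) there exist C > 0 and K ∈ ℕ such that | â_{k+1} − (4/π) 2^{−kp} | ≤ C · 2^{−3kp} for all k ≥ K. -/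
open MeasureTheory
open scoped Classical

/-- The open Euclidean ball of center `z` and radius `r` in `ℝ²`. -/
def euclBall (z : ℝ × ℝ) (r : ℝ) : Set (ℝ × ℝ) :=
  {w | Real.sqrt ((w.1 - z.1) ^ 2 + (w.2 - z.2) ^ 2) < r}


lemma nondy_step {y : ℝ} (h : Nondyadic y) (c : ℤ) : Nondyadic (2 * y - c) := by
  intro m l e
  apply h (m + c * 2 ^ l) (l + 1)
  have h2 : (2:ℝ) ^ l ≠ 0 := by positivity
  rw [eq_div_iff (by positivity)]
  rw [eq_div_iff h2] at e
  push_cast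
  rw [pow_succ]
  linarith

lemma baker_nondy {w : ℝ × ℝ} (h : Nondyadic w.2) : Nondyadic (bakerMap w).2 := by
  unfold bakerMap
  split_ifs
  · simpa using nondy_step h 0
  · simpa using nondy_step h 1

lemma baker_local (z : ℝ × ℝ) (h : Nondyadic z.2) (j : ℕ) :
    Nondyadic (bakerMap^[j] z).2 ∧ ∃ ρ > (0:ℝ), ∀ w : ℝ × ℝ, |w.2 - z.2| < ρ →
      bakerMap^[j] w = ((bakerMap^[j] z).1 + (w.1 - z.1) / 2 ^ j,
        (bakerMap^[j] z).2 + 2 ^ j * (w.2 - z.2)) := by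
  induction j with
  | zero =>
    refine ⟨h, 1, one_pos, fun w _ => ?_⟩
    ext <;> simp
  | succ j ih =>
    obtain ⟨hn, ρ, hρ, H⟩ := ih
    simp only [Function.iterate_succ_apply']
    refine ⟨baker_nondy hn, ?_⟩
    set q := bakerMap^[j] z with hq
    have hne : q.2 ≠ 1 / 2 := by simpa using hn 1 1
    have hd : 0 < |q.2 - 1 / 2| := abs_pos.mpr (sub_ne_zero.mpr hne)
    have h2 : (0:ℝ) < 2 ^ j := by positivity
    refine ⟨min ρ (|q.2 - 1 / 2| / 2 ^ j), lt_min hρ (by positivity), fun w hw => ?_⟩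
    rw [H w (lt_of_lt_of_le hw (min_le_left _ _))]
    have h3 := lt_of_lt_of_le hw (min_le_right _ _)
    rw [lt_div_iff₀ h2] at h3
    have h4 : |2 ^ j * (w.2 - z.2)| < |q.2 - 1 / 2| := by
      rw [abs_mul, abs_of_pos h2]; linarith
    have h5 := abs_lt.mp h4
    unfold bakerMap
    rcases lt_or_gt_of_ne hne with hl | hl
    · rw [abs_of_neg (by linarith)] at h5
      rw [if_pos (by dsimp only; linarith), if_pos hl]
      ext
      · simp only [pow_succ]; field_simp
      · simp only [pow_succ]; ring
    · rw [abs_of_pos (by linarith)] at h5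
      rw [if_neg (by dsimp only; linarith), if_neg (by linarith)]
      ext
      · simp only [pow_succ]; field_simp; ring
      · simp only [pow_succ]; ring

/-- Normalized intersection of ellipses. -/
def ellInter (p k : ℕ) : Set (ℝ × ℝ) :=
  {w | ∀ i ∈ Finset.range (k + 1),
    (w.1 / 2 ^ (i * p)) ^ 2 + (2 ^ (i * p) * w.2) ^ 2 < 1}

lemma mem_euclBall {z w : ℝ × ℝ} {r : ℝ} (hr : 0 < r) :
    w ∈ euclBall z r ↔ (w.1 - z.1) ^ 2 + (w.2 - z.2) ^ 2 < r ^ 2 := by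
  unfold euclBall
  rw [Set.mem_setOf_eq, Real.sqrt_lt' hr]

lemma vol_scale (z : ℝ × ℝ) {r : ℝ} (hr : 0 < r) (S : Set (ℝ × ℝ)) :
    (volume {w : ℝ × ℝ | r⁻¹ • (w - z) ∈ S}).toReal = r ^ 2 * (volume S).toReal := by
  have h1 : {w : ℝ × ℝ | r⁻¹ • (w - z) ∈ S} = (fun w => w - z) ⁻¹' ((r⁻¹ • ·) ⁻¹' S) := rfl
  have : (volume : Measure (ℝ × ℝ)).IsAddHaarMeasure :=
    inferInstanceAs ((volume : Measure ℝ).prod (volume : Measure ℝ)).IsAddHaarMeasure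
  rw [h1]
  simp only [sub_eq_add_neg]
  rw [measure_preimage_add_right, Measure.addHaar_preimage_smul _ (by positivity)]
  rw [ENNReal.toReal_mul, ENNReal.toReal_ofReal (abs_nonneg _), abs_of_pos (by positivity)]
  simp

lemma euclBall_vol (z : ℝ × ℝ) {r : ℝ} (hr : 0 < r) :
    (volume (euclBall z r)).toReal = r ^ 2 * Real.pi := by
  have h := Complex.volume_preserving_equiv_real_prod.symm.measure_preimage_equiv
    (Metric.ball (Complex.measurableEquivRealProd.symm z) r)
  have e : Complex.measurableEquivRealProd.symm ⁻¹'
      (Metric.ball (Complex.measurableEquivRealProd.symm z) r) = euclBall z r := by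
    ext w
    rw [mem_euclBall hr, Set.mem_preimage, Metric.mem_ball, Complex.dist_eq,
      Complex.norm_def, Real.sqrt_lt' hr, Complex.normSq_apply]
    simp [Complex.measurableEquivRealProd, pow_two]
  rw [← e, h, Complex.volume_ball]
  simp [hr.le]

lemma box_vol (a b : ℝ) (ha : 0 ≤ a) (hb : 0 ≤ b) :
    volume (Set.Ioo (-a) a ×ˢ Set.Ioo (-b) b) = ENNReal.ofReal (4 * a * b) := by
  rw [Measure.volume_eq_prod, Measure.prod_prod, Real.volume_Ioo, Real.volume_Ioo,
    ← ENNReal.ofReal_mul (by linarith)]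
  congr 1; ring

lemma ell_upper (p k : ℕ) :
    ellInter p k ⊆ Set.Ioo (-1:ℝ) 1 ×ˢ Set.Ioo (-(2 ^ (k * p) : ℝ)⁻¹) (2 ^ (k * p) : ℝ)⁻¹ := by
  intro w hw
  have h0 := hw 0 (by simp)
  have h1 := hw k (by simp)
  have hN : (0:ℝ) < 2 ^ (k * p) := by positivity
  have a1 : |w.1| < 1 := by
    rw [← sq_lt_one_iff_abs_lt_one]
    simp at h0
    nlinarith [sq_nonneg w.2]
  have a2 : |2 ^ (k * p) * w.2| < 1 := by
    rw [← sq_lt_one_iff_abs_lt_one]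
    nlinarith [sq_nonneg (w.1 / 2 ^ (k * p))]
  rw [abs_mul, abs_of_pos hN, mul_comm, ← lt_div_iff₀ hN, one_div] at a2
  exact ⟨abs_lt.mp a1, abs_lt.mp a2⟩

lemma ell_lower (p k : ℕ) (N e : ℝ) (hN : N = 2 ^ (k * p)) (he : e = 1 / N ^ 2) :
    Set.Ioo (-(1 - e)) (1 - e) ×ˢ Set.Ioo (-((1 - e) / N)) ((1 - e) / N) ⊆ ellInter p k := by
  rintro ⟨u, v⟩ ⟨hu, hv⟩ i hi
  simp only at hu hv ⊢
  have hN1 : 1 ≤ N := by rw [hN]; exact one_le_pow₀ (by norm_num)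
  have he0 : 0 < e := by rw [he]; positivity
  have hpos : 0 < 1 - e := by have := hu.1.trans hu.2; linarith
  set t : ℝ := 2 ^ (i * p) with ht
  have ht1 : 1 ≤ t := one_le_pow₀ (by norm_num)
  have htN : t ≤ N := by
    rw [hN]
    exact pow_le_pow_right₀ (by norm_num)
      (Nat.mul_le_mul_right _ (by simpa [Nat.lt_succ_iff] using hi))
  have hu2 : u ^ 2 < (1 - e) ^ 2 := sq_lt_sq' hu.1 hu.2
  have hv2 : v ^ 2 < (1 - e) ^ 2 * e := by
    have := sq_lt_sq' hv.1 hv.2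
    rw [he] at this ⊢
    rw [div_pow] at this
    rw [mul_one_div]; exact this
  have ht0 : 0 < t := by linarith
  set s := t ^ 2 with hs
  have hs1 : 1 ≤ s := one_le_pow₀ ht1
  have hsN : s * e ≤ 1 := by
    rw [he, mul_one_div, div_le_one (by positivity)]
    exact pow_le_pow_left₀ ht0.le htN 2
  have hs0 : 0 < s := by linarith
  rw [div_pow, mul_pow, ← hs]
  have h1 : u ^ 2 / s + s * v ^ 2 < (1 - e) ^ 2 / s + s * ((1 - e) ^ 2 * e) := by gcongr
  have h2 : 1 / s + s * e ≤ 1 + e := by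
    rw [div_add' _ _ _ hs0.ne', div_le_iff₀ hs0]
    nlinarith
  have h3 : (1 - e) ^ 2 / s + s * ((1 - e) ^ 2 * e) = (1 - e) ^ 2 * (1 / s + s * e) := by ring
  have h4 : (1 - e) ^ 2 * (1 / s + s * e) ≤ (1 - e) ^ 2 * (1 + e) := by gcongr
  have h5 : (1 - e) ^ 2 * (1 + e) ≤ 1 := by nlinarith [mul_pos he0 hpos, mul_pos he0 he0]
  linarith

lemma ell_est (p k : ℕ) :
    |(volume (ellInter p k)).toReal - 4 / (2:ℝ) ^ (k * p)| ≤ 8 / ((2:ℝ) ^ (k * p)) ^ 3 := by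
  obtain ⟨N, hN⟩ : ∃ N : ℝ, N = 2 ^ (k * p) := ⟨_, rfl⟩
  have hN1 : 1 ≤ N := by rw [hN]; exact one_le_pow₀ (by norm_num)
  have hN0 : 0 < N := by linarith
  have he1 : 1 / N ^ 2 ≤ 1 := by
    rw [div_le_one (by positivity)]; exact one_le_pow₀ hN1
  have hU := measure_mono (μ := volume) (ell_upper p k)
  have hL := measure_mono (μ := volume) (ell_lower p k N _ hN rfl)
  rw [← hN] at hU ⊢
  rw [box_vol _ _ zero_le_one (by positivity)] at hU
  rw [box_vol _ _ (by linarith) (div_nonneg (by linarith) hN0.le)] at hL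
  have hfin : volume (ellInter p k) ≠ ⊤ := ne_top_of_le_ne_top ENNReal.ofReal_ne_top hU
  have hU' := ENNReal.toReal_le_of_le_ofReal (by positivity) hU
  have hL' := (ENNReal.ofReal_le_iff_le_toReal hfin).mp hL
  have hx : 4 * (1 - 1 / N ^ 2) * ((1 - 1 / N ^ 2) / N) = 4 / N - 8 / N ^ 3 + 4 / N ^ 5 := by
    field_simp; ring
  rw [hx] at hL'
  have h5 : 0 < 4 / N ^ 5 := by positivity
  have h3 : 0 < 8 / N ^ 3 := by positivity
  have : 4 * 1 * N⁻¹ = 4 / N := by ring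
  rw [abs_le]; constructor <;> linarith

lemma inter_eq (z : ℝ × ℝ) (hy : Nondyadic z.2) (p : ℕ) (hper : bakerMap^[p] z = z) (k : ℕ) :
    ∃ rk > (0:ℝ), ∀ r : ℝ, 0 < r → r < rk →
      (⋂ i ∈ Finset.range (k + 1), bakerMap^[i * p] ⁻¹' euclBall z r) =
        {w : ℝ × ℝ | r⁻¹ • (w - z) ∈ ellInter p k} := by
  have hp' : ∀ i, bakerMap^[i * p] z = z := fun i => by
    rw [mul_comm, Function.iterate_mul]
    exact Function.iterate_fixed hper i
  choose ρ hρ H using fun i => (baker_local z hy (i * p)).2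
  obtain ⟨rk, hrk, hle⟩ : ∃ rk > (0:ℝ), ∀ i ∈ Finset.range (k + 1), rk ≤ ρ i := by
    refine ⟨(Finset.range (k + 1)).inf' Finset.nonempty_range_add_one ρ, ?_, fun i hi => Finset.inf'_le _ hi⟩
    rw [gt_iff_lt, Finset.lt_inf'_iff]
    exact fun i _ => hρ i
  refine ⟨rk, hrk, fun r hr hlt => ?_⟩
  have key : ∀ w : ℝ × ℝ, |w.2 - z.2| < r → ∀ i ∈ Finset.range (k + 1),
      (bakerMap^[i * p] w ∈ euclBall z r ↔
        ((r⁻¹ • (w - z)).1 / 2 ^ (i * p)) ^ 2 + (2 ^ (i * p) * (r⁻¹ • (w - z)).2) ^ 2 < 1) := by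
    intro w hw i hi
    rw [mem_euclBall hr, H i w (by linarith [hle i hi]), hp' i]
    simp only [add_sub_cancel_left, Prod.smul_fst, Prod.smul_snd, Prod.fst_sub, Prod.snd_sub,
      smul_eq_mul]
    have : (r⁻¹ * (w.1 - z.1) / 2 ^ (i * p)) ^ 2 + (2 ^ (i * p) * (r⁻¹ * (w.2 - z.2))) ^ 2
      = (((w.1 - z.1) / 2 ^ (i * p)) ^ 2 + (2 ^ (i * p) * (w.2 - z.2)) ^ 2) / r ^ 2 := by
      field_simp
    rw [this, div_lt_one (by positivity)]
  ext w
  simp only [Set.mem_iInter, Set.mem_preimage, Set.mem_setOf_eq]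
  constructor
  · intro h i hi
    refine (key w ?_ i hi).mp (h i hi)
    have h0 := h 0 (by simp)
    simp only [zero_mul, Function.iterate_zero, id] at h0
    rw [mem_euclBall hr] at h0
    exact abs_lt_of_sq_lt_sq (by nlinarith [sq_nonneg (w.1 - z.1)]) hr.le
  · intro h i hi
    refine (key w ?_ i hi).mpr (h i hi)
    have h0 := h 0 (by simp)
    simp only [zero_mul, pow_zero, div_one, one_mul, Prod.smul_fst, Prod.smul_snd, Prod.fst_sub,
      Prod.snd_sub, smul_eq_mul] at h0
    have h1 : (r⁻¹ * (w.2 - z.2)) ^ 2 < 1 := by nlinarith [sq_nonneg (r⁻¹ * (w.1 - z.1))]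
    have h2 : (r⁻¹ * (w.2 - z.2)) ^ 2 = (w.2 - z.2) ^ 2 / r ^ 2 := by field_simp
    rw [h2, div_lt_one (by positivity)] at h1
    exact abs_lt_of_sq_lt_sq h1 hr.le

/-- At a periodic point `z ∈ (0,1)²` of minimal period `p` with non-dyadic
coordinates: (i) for every `k` the ratio
`Leb(⋂_{i=0}^k T^{-ip} B(z,r)) / Leb(B(z,r))` (Euclidean balls) is a constant
`â_{k+1}` independent of `r` for all small `r`; and (ii)
`â_{k+1} = (4/π) 2^{-kp} (1 + O(2^{-2kp}))`. -/
theorem stmt_11 (z : ℝ × ℝ) (hz : z ∈ Set.Ioo (0:ℝ) 1 ×ˢ Set.Ioo (0:ℝ) 1)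
    (hx : Nondyadic z.1) (hy : Nondyadic z.2) (p : ℕ) (hp : 1 ≤ p)
    (hper : bakerMap^[p] z = z)
    (hmin : ∀ j, 1 ≤ j → j < p → bakerMap^[j] z ≠ z) :
    ∃ a : ℕ → ℝ,
      (∀ k : ℕ, ∃ rk > (0:ℝ), ∀ r : ℝ, 0 < r → r < rk →
        (volume (⋂ i ∈ Finset.range (k + 1), bakerMap^[i * p] ⁻¹' euclBall z r)).toReal /
          (volume (euclBall z r)).toReal = a k) ∧
      ∃ C > (0:ℝ), ∃ K : ℕ, ∀ k ≥ K,
        |a k - 4 / Real.pi * (2 : ℝ) ^ (-(k * p : ℤ))| ≤ C * (2 : ℝ) ^ (-(3 * k * p : ℤ)) := by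
  refine ⟨fun k => (volume (ellInter p k)).toReal / Real.pi, fun k => ?_, 8 / Real.pi,
    by positivity, 0, fun k _ => ?_⟩
  · obtain ⟨rk, hrk, H⟩ := inter_eq z hy p hper k
    refine ⟨rk, hrk, fun r hr hlt => ?_⟩
    rw [H r hr hlt, vol_scale z hr, euclBall_vol z hr, mul_div_mul_left _ _ (by positivity)]
  · have h := ell_est p k
    have e1 : (2:ℝ) ^ (-(k * p : ℤ)) = ((2:ℝ) ^ (k * p))⁻¹ := by
      rw [zpow_neg]; norm_cast
    have e2 : (2:ℝ) ^ (-(3 * k * p : ℤ)) = (((2:ℝ) ^ (k * p)) ^ 3)⁻¹ := by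
      rw [zpow_neg, ← pow_mul, show k * p * 3 = 3 * k * p by ring]; norm_cast
    rw [e1, e2]
    have e3 : (volume (ellInter p k)).toReal / Real.pi - 4 / Real.pi * ((2:ℝ) ^ (k * p))⁻¹ =
      ((volume (ellInter p k)).toReal - 4 / (2:ℝ) ^ (k * p)) / Real.pi := by ring
    have e4 : 8 / Real.pi * (((2:ℝ) ^ (k * p)) ^ 3)⁻¹ = 8 / ((2:ℝ) ^ (k * p)) ^ 3 / Real.pi := by
      ring
    simp only
    rw [e3, e4, abs_div, abs_of_pos Real.pi_pos]
    gcongr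
end

section
/- Let T be the standard baker's map, T(x,y) = (x/2, 2y) if y < 1/2 and T(x,y) = ((x+1)/2, 2y−1) if y ≥ 1/2, let z ∈ (0,1)² be a periodic point of minimal period p whose coordinates are both non-dyadic, and for k ≥ 0 let â_{k+1} := lim_{r→0} Leb( ⋂_{i=0}^{k} T^{−ip} B(z, r) ) / Leb( B(z, r) ), where B(z,r) is the open Euclidean ball. Set θ := 1 − â₂. Then there exists k ≥ 1 such that â_{k+1} ≠ (1 − θ)^k. -/
open MeasureTheory Filter
open scoped Classical Topology

lemma nd_step (z : ℝ × ℝ) (hy : Nondyadic z.2) : Nondyadic (bakerMap z).2 := by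
  intro m l h
  unfold bakerMap at h
  split_ifs at h
  · apply hy m (l + 1)
    simp only at h
    rw [pow_succ, ← div_div, ← h]; ring
  · apply hy (m + 2 ^ l) (l + 1)
    simp only at h
    have h2 : (2:ℝ) ^ l ≠ 0 := by positivity
    push_cast
    rw [pow_succ, ← div_div, add_div, ← h, div_self h2]; ring

lemma local_step (z : ℝ × ℝ) (hy : Nondyadic z.2) : ∀ᶠ w in 𝓝 z,
    bakerMap w = ((bakerMap z).1 + (w.1 - z.1) / 2, (bakerMap z).2 + 2 * (w.2 - z.2)) := by
  have hne : z.2 ≠ 1 / 2 := by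
    have := hy 1 1
    simpa using this
  have hc : Tendsto (fun w : ℝ × ℝ => w.2) (𝓝 z) (𝓝 z.2) := continuous_snd.tendsto z
  rcases lt_or_gt_of_ne hne with h | h
  · filter_upwards [hc.eventually (gt_mem_nhds h)] with w hw
    unfold bakerMap
    rw [if_pos hw, if_pos h]
    ext <;> simp only <;> ring
  · filter_upwards [hc.eventually (lt_mem_nhds h)] with w hw
    unfold bakerMap
    rw [if_neg (not_lt.mpr hw.le), if_neg (not_lt.mpr h.le)]
    ext <;> simp only <;> ring

lemma local_iter (n : ℕ) : ∀ z : ℝ × ℝ, Nondyadic z.2 → ∀ᶠ w in 𝓝 z,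
    bakerMap^[n] w = ((bakerMap^[n] z).1 + (w.1 - z.1) / 2 ^ n,
      (bakerMap^[n] z).2 + 2 ^ n * (w.2 - z.2)) := by
  induction n with
  | zero => intro z _; filter_upwards with w; ext <;> simp
  | succ n ih =>
    intro z hy
    have h1 := local_step z hy
    have h2 := ih _ (nd_step z hy)
    have hc : Tendsto bakerMap (𝓝 z) (𝓝 (bakerMap z)) := by
      have hcont : Tendsto (fun w : ℝ × ℝ => ((bakerMap z).1 + (w.1 - z.1) / 2,
          (bakerMap z).2 + 2 * (w.2 - z.2))) (𝓝 z) (𝓝 (bakerMap z)) := by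
        have hh : Continuous (fun w : ℝ × ℝ => ((bakerMap z).1 + (w.1 - z.1) / 2,
          (bakerMap z).2 + 2 * (w.2 - z.2))) := by fun_prop
        have := hh.tendsto z
        simpa using this
      refine hcont.congr' ?_
      filter_upwards [h1] with w hw using hw.symm
    filter_upwards [h1, hc.eventually h2] with w hw1 hw2
    rw [Function.iterate_succ_apply, Function.iterate_succ_apply, hw2, hw1]
    ext
    · simp only [pow_succ]; field_simp; ring
    · simp only [pow_succ]; ring

lemma mem_ball_iff (z w : ℝ × ℝ) (r : ℝ) (hr : 0 < r) :
    w ∈ euclBall z r ↔ (w.1 - z.1) ^ 2 + (w.2 - z.2) ^ 2 < r ^ 2 := by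
  unfold euclBall
  rw [Set.mem_setOf_eq, Real.sqrt_lt' hr]

lemma vol_ball (z : ℝ × ℝ) (r : ℝ) (hr : 0 < r) :
    (volume (euclBall z r)).toReal = Real.pi * r ^ 2 := by
  have h := Complex.volume_preserving_equiv_real_prod.measure_preimage_equiv (euclBall z r)
  have h2 : Complex.measurableEquivRealProd ⁻¹' (euclBall z r) = Metric.ball (⟨z.1, z.2⟩ : ℂ) r := by
    ext w
    rw [Set.mem_preimage, Metric.mem_ball, Complex.dist_eq_re_im]
    rfl
  rw [← h, h2, Complex.volume_ball]
  simp [ENNReal.toReal_ofReal hr.le]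
  ring

lemma vol_box (z : ℝ × ℝ) (A B : ℝ) (hA : 0 ≤ A) (hB : 0 ≤ B) :
    volume (Set.Ioo (z.1 - A) (z.1 + A) ×ˢ Set.Ioo (z.2 - B) (z.2 + B)) =
      ENNReal.ofReal (4 * A * B) := by
  rw [Measure.volume_eq_prod, Measure.prod_prod, Real.volume_Ioo, Real.volume_Ioo,
    ← ENNReal.ofReal_mul (by linarith)]
  congr 1; ring

lemma local_per (z : ℝ × ℝ) (hy : Nondyadic z.2) (p : ℕ) (hper : bakerMap^[p] z = z) (i : ℕ) :
    ∀ᶠ r in 𝓝[>] (0:ℝ), ∀ w ∈ euclBall z r, (bakerMap^[i * p] w ∈ euclBall z r ↔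
      ((w.1 - z.1) / (2 ^ p) ^ i) ^ 2 + ((2 ^ p) ^ i * (w.2 - z.2)) ^ 2 < r ^ 2) := by
  have h := local_iter (i * p) z hy
  have hz : bakerMap^[i * p] z = z := by
    rw [mul_comm, Function.iterate_mul]
    exact Function.iterate_fixed hper i
  rw [hz] at h
  obtain ⟨ε, hε, h⟩ := Metric.eventually_nhds_iff.1 h
  filter_upwards [Ioo_mem_nhdsGT hε] with r hr w hw
  have hr0 : 0 < r := hr.1
  have hw' := (mem_ball_iff z w r hr0).1 hw
  have hd : dist w z < ε := by
    rw [Prod.dist_eq, max_lt_iff, Real.dist_eq, Real.dist_eq]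
    constructor
    · exact (abs_lt_of_sq_lt_sq (by nlinarith [sq_nonneg (w.2 - z.2)]) hr0.le).trans hr.2
    · exact (abs_lt_of_sq_lt_sq (by nlinarith [sq_nonneg (w.1 - z.1)]) hr0.le).trans hr.2
  rw [mem_ball_iff _ _ _ hr0, h hd]
  simp only [add_sub_cancel_left, mul_comm i p, pow_mul]

/-- For the standard baker's map and a periodic point `z ∈ (0,1)²` of minimal
period `p` with non-dyadic coordinates, let
`â_{k+1} = lim_{r→0} Leb(⋂_{i=0}^k T^{-ip} B(z,r)) / Leb(B(z,r))` (Euclidean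
balls) and `θ = 1 - â₂`. Then there exists `k ≥ 1` with `â_{k+1} ≠ (1-θ)^k`:
the limiting compound Poisson distribution at `z` is not Pólya–Aeppli. -/
theorem stmt_12 (z : ℝ × ℝ) (hz : z ∈ Set.Ioo (0:ℝ) 1 ×ˢ Set.Ioo (0:ℝ) 1)
    (hx : Nondyadic z.1) (hy : Nondyadic z.2) (p : ℕ) (hp : 1 ≤ p)
    (hper : bakerMap^[p] z = z)
    (hmin : ∀ j, 1 ≤ j → j < p → bakerMap^[j] z ≠ z)
    (a : ℕ → ℝ)
    (ha : ∀ k : ℕ, Tendsto (fun r : ℝ =>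
        (volume (⋂ i ∈ Finset.range (k + 1), bakerMap^[i * p] ⁻¹' euclBall z r)).toReal /
          (volume (euclBall z r)).toReal)
      (𝓝[>] 0) (𝓝 (a k)))
    (θ : ℝ) (hθ : θ = 1 - a 1) :
    ∃ k : ℕ, 1 ≤ k ∧ a k ≠ (1 - θ) ^ k := by
  by_contra hcon
  push Not at hcon
  have e2 := hcon 2 (by norm_num)
  have e4 := hcon 4 (by norm_num)
  set q : ℝ := 2 ^ p with hq
  have hq2 : 2 ≤ q := by
    calc (2:ℝ) = 2 ^ 1 := by norm_num
      _ ≤ 2 ^ p := pow_le_pow_right₀ (by norm_num) hp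
  have hq0 : 0 < q := by linarith
  have hpi := Real.pi_pos
  have up : a 4 ≤ 4 / (Real.pi * q ^ 4) := by
    refine le_of_tendsto (ha 4) ?_
    filter_upwards [local_per z hy p hper 4, self_mem_nhdsWithin] with r h4 hr
    have hr0 : 0 < r := hr
    rw [vol_ball z r hr0, div_le_div_iff₀ (by positivity) (by positivity)]
    have hsub : (⋂ i ∈ Finset.range (4 + 1), bakerMap^[i * p] ⁻¹' euclBall z r) ⊆
        Set.Ioo (z.1 - r) (z.1 + r) ×ˢ Set.Ioo (z.2 - r / q ^ 4) (z.2 + r / q ^ 4) := by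
      intro w hw
      simp only [Set.mem_iInter, Finset.mem_range, Set.mem_preimage] at hw
      have w0 : w ∈ euclBall z r := by simpa using hw 0 (by norm_num)
      have w4 := (h4 w w0).1 (hw 4 (by norm_num))
      rw [mem_ball_iff _ _ _ hr0] at w0
      have b1 := abs_lt.1 (abs_lt_of_sq_lt_sq (show (w.1 - z.1) ^ 2 < r ^ 2 by
        nlinarith [sq_nonneg (w.2 - z.2)]) hr0.le)
      have b2 := (abs_lt_of_sq_lt_sq (show (q ^ 4 * (w.2 - z.2)) ^ 2 < r ^ 2 by
        nlinarith [sq_nonneg ((w.1 - z.1) / q ^ 4)]) hr0.le)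
      rw [abs_mul, abs_of_pos (by positivity : 0 < q ^ 4), mul_comm,
        ← lt_div_iff₀ (by positivity)] at b2
      have b2 := abs_lt.1 b2
      refine ⟨⟨?_, ?_⟩, ⟨?_, ?_⟩⟩ <;> linarith [b1.1, b1.2, b2.1, b2.2]
    have hv := measure_mono (μ := volume) hsub
    rw [vol_box z _ _ hr0.le (by positivity)] at hv
    have hv' := ENNReal.toReal_le_of_le_ofReal (by positivity) hv
    calc _ ≤ (4 * r * (r / q ^ 4)) * (Real.pi * q ^ 4) := by gcongr
      _ = _ := by field_simp
  have low : 4 * (24 / 25) ^ 2 / (Real.pi * q ^ 2) ≤ a 2 := by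
    refine ge_of_tendsto (ha 2) ?_
    filter_upwards [local_per z hy p hper 1, local_per z hy p hper 2, self_mem_nhdsWithin]
      with r h1 h2 hr
    have hr0 : 0 < r := hr
    rw [vol_ball z r hr0, div_le_div_iff₀ (by positivity) (by positivity)]
    have hsub : Set.Ioo (z.1 - 24 / 25 * r) (z.1 + 24 / 25 * r) ×ˢ
        Set.Ioo (z.2 - 24 / 25 * r / q ^ 2) (z.2 + 24 / 25 * r / q ^ 2) ⊆
        (⋂ i ∈ Finset.range (2 + 1), bakerMap^[i * p] ⁻¹' euclBall z r) := by
      rintro w ⟨⟨c1, c2⟩, ⟨c3, c4⟩⟩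
      have b1 : (w.1 - z.1) ^ 2 ≤ (24 / 25 * r) ^ 2 :=
        sq_le_sq' (by linarith) (by linarith)
      have b2 : (q ^ 2 * (w.2 - z.2)) ^ 2 ≤ (24 / 25 * r) ^ 2 := by
        have : |w.2 - z.2| < 24 / 25 * r / q ^ 2 := abs_lt.2 ⟨by linarith, by linarith⟩
        rw [lt_div_iff₀ (by positivity)] at this
        rw [← sq_abs (q ^ 2 * (w.2 - z.2)), abs_mul, abs_of_pos (by positivity : 0 < q ^ 2)]
        refine pow_le_pow_left₀ (by positivity) ?_ 2
        linarith
      have hs : 4 ≤ q ^ 2 := by nlinarith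
      set u := (w.1 - z.1) ^ 2 with hu
      set v := (w.2 - z.2) ^ 2 with hv
      have b2' : (q ^ 2) ^ 2 * v ≤ (24 / 25 * r) ^ 2 := by rw [hv, ← mul_pow]; exact b2
      have v0 : 0 ≤ v := sq_nonneg _
      have u0 : 0 ≤ u := sq_nonneg _
      have r2 : 0 < r ^ 2 := by positivity
      have b3 : q ^ 2 * v ≤ (24 / 25 * r) ^ 2 / 4 := by
        have : 4 * (q ^ 2 * v) ≤ q ^ 2 * (q ^ 2 * v) := by gcongr
        linarith
      have b4 : v ≤ (24 / 25 * r) ^ 2 / 16 := by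
        have : 4 * v ≤ q ^ 2 * v := by gcongr
        linarith
      have u1 : u / q ^ 2 ≤ (24 / 25 * r) ^ 2 / 4 := by gcongr
      have u2 : u / (q ^ 2) ^ 2 ≤ (24 / 25 * r) ^ 2 / 4 ^ 2 := by gcongr
      have w0 : w ∈ euclBall z r := by
        rw [mem_ball_iff _ _ _ hr0]; nlinarith
      simp only [Set.mem_iInter, Finset.mem_range, Set.mem_preimage]
      intro i hi
      interval_cases i
      · simpa using w0
      · rw [h1 w w0, pow_one, div_pow, mul_pow]; nlinarith
      · rw [h2 w w0, div_pow, mul_pow]; nlinarith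
    have hv := measure_mono (μ := volume) hsub
    rw [vol_box z _ _ (by positivity) (by positivity)] at hv
    have hfin : volume (⋂ i ∈ Finset.range (2 + 1), bakerMap^[i * p] ⁻¹' euclBall z r) ≠ ⊤ := by
      have hs : (⋂ i ∈ Finset.range (2 + 1), bakerMap^[i * p] ⁻¹' euclBall z r) ⊆ euclBall z r := by
        intro w hw
        simp only [Set.mem_iInter, Finset.mem_range, Set.mem_preimage] at hw
        simpa using hw 0 (by norm_num)
      refine ne_top_of_le_ne_top ?_ (measure_mono hs)
      intro ht
      have := vol_ball z r hr0
      rw [ht] at this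
      have h3 : 0 < Real.pi * r ^ 2 := by positivity
      simp at this
      simp [hr0.ne'] at this
    have hv' := (ENNReal.ofReal_le_iff_le_toReal hfin).1 hv
    calc _ = (4 * (24 / 25 * r) * (24 / 25 * r / q ^ 2)) * (Real.pi * q ^ 2) := by field_simp
      _ ≤ _ := by gcongr
  have e : a 4 = a 2 ^ 2 := by rw [e2, e4]; ring
  have h0 : 0 ≤ 4 * (24 / 25) ^ 2 / (Real.pi * q ^ 2) := by positivity
  have h5 : (4 * (24 / 25) ^ 2 / (Real.pi * q ^ 2)) ^ 2 ≤ 4 / (Real.pi * q ^ 4) := by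
    rw [e] at up
    exact (pow_le_pow_left₀ h0 low 2).trans up
  rw [div_pow, div_le_div_iff₀ (by positivity) (by positivity)] at h5
  have h6 : 0 < Real.pi * q ^ 4 := by positivity
  have h7 := Real.pi_lt_d2
  nlinarith
end

section
/- Let T be the standard baker's map, T(x,y) = (x/2, 2y) if y < 1/2 and T(x,y) = ((x+1)/2, 2y−1) if y ≥ 1/2, preserving Lebesgue measure Leb on [0,1]². Let z ∈ (0,1)² be a periodic point of minimal period p whose coordinates are both non-dyadic. Then for every τ > 0 and every sequence (u_n) of reals satisfying n · Leb(B_∞(z, e^{−u_n})) → τ as n → ∞, one has Leb( { x ∈ [0,1]² : max_{0 ≤ j ≤ n−1} ( −log d_∞(T^j x, z) ) ≤ u_n } ) → e^{−(1 − 2^{−p}) τ} as n → ∞, where d_∞ is the ℓ^∞ (sup) distance on ℝ² and B_∞(z,r) the corresponding open ball. -/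
open MeasureTheory Filter
open scoped Classical Topology

/-- The unit square `[0,1]²`. -/
def unitSq : Set (ℝ × ℝ) := Set.Icc (0:ℝ) 1 ×ˢ Set.Icc (0:ℝ) 1


noncomputable def lam : Measure ℝ := volume.restrict (Set.Ico (0:ℝ) 1)
noncomputable def mu : Measure (ℝ × ℝ) := lam.prod lam

instance lam_prob : IsProbabilityMeasure lam := ⟨by simp [lam]⟩
instance mu_prob : IsProbabilityMeasure mu := by unfold mu; infer_instance

lemma mu_eq : volume.restrict unitSq = mu := by
  unfold mu lam unitSq
  rw [Measure.restrict_congr_set (Ico_ae_eq_Icc (μ := (volume : Measure ℝ)) (a := 0) (b := 1)),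
    Measure.prod_restrict, ← Measure.volume_eq_prod]

lemma baker_meas : Measurable bakerMap := by
  unfold bakerMap
  refine Measurable.ite (measurableSet_lt measurable_snd measurable_const) ?_ ?_ <;> fun_prop

lemma vol_aff (a b : ℝ) (ha : a ≠ 0) (S : Set ℝ) :
    volume ((fun x : ℝ => a * x + b) ⁻¹' S) = ENNReal.ofReal |a⁻¹| * volume S := by
  have : (fun x : ℝ => a * x + b) ⁻¹' S = (a * ·) ⁻¹' ((· + b) ⁻¹' S) := rfl
  rw [this, Real.volume_preimage_mul_left ha, measure_preimage_add_right]

lemma mp : MeasurePreserving bakerMap mu mu := by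
  refine ⟨baker_meas, ?_⟩
  symm
  refine Measure.prod_eq fun s t hs ht => ?_
  rw [Measure.map_apply baker_meas (hs.prod ht)]
  have e : bakerMap ⁻¹' (s ×ˢ t) =
      (((fun x : ℝ => (1/2) * x + 0) ⁻¹' s) ×ˢ (((fun x : ℝ => 2 * x + 0) ⁻¹' t) ∩ Set.Iio (1/2)))
      ∪ (((fun x : ℝ => (1/2) * x + 1/2) ⁻¹' s) ×ˢ
          (((fun x : ℝ => 2 * x + (-1)) ⁻¹' t) ∩ Set.Ici (1/2))) := by
    ext ⟨x, y⟩
    have h1 : (x + 1) / 2 = 1/2 * x + 1/2 := by ring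
    have h2 : x / 2 = 1/2 * x := by ring
    simp only [bakerMap, Set.mem_preimage, Set.mem_prod, Set.mem_union, Set.mem_inter_iff,
      Set.mem_Iio, Set.mem_Ici, add_zero, ← sub_eq_add_neg, h1, h2]
    by_cases h : y < 1/2
    · simp only [h, if_true, not_le.mpr h]; tauto
    · simp only [h, if_false, not_lt.mp h]; tauto
  have m0 : MeasurableSet ((fun x : ℝ => (1/2) * x + 0) ⁻¹' s) := hs.preimage (by fun_prop)
  have m1 : MeasurableSet ((fun x : ℝ => (1/2) * x + 1/2) ⁻¹' s) := hs.preimage (by fun_prop)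
  have m2 : MeasurableSet ((fun x : ℝ => 2 * x + 0) ⁻¹' t) := ht.preimage (by fun_prop)
  have m3 : MeasurableSet ((fun x : ℝ => 2 * x + (-1)) ⁻¹' t) := ht.preimage (by fun_prop)
  rw [e, measure_union _ (m1.prod (m3.inter measurableSet_Ici))]
  · unfold mu
    rw [Measure.prod_prod, Measure.prod_prod]
    have k0 : lam ((fun x : ℝ => (1/2) * x + 0) ⁻¹' s) = 2 * volume (s ∩ Set.Ico 0 (1/2)) := by
      have : (fun x : ℝ => (1/2) * x + 0) ⁻¹' s ∩ Set.Ico 0 1 =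
         (fun x : ℝ => (1/2) * x + 0) ⁻¹' (s ∩ Set.Ico 0 (1/2)) := by
        ext x; simp only [Set.mem_inter_iff, Set.mem_preimage, Set.mem_Ico]
        refine and_congr_right fun _ => ?_
        constructor <;> rintro ⟨_, _⟩ <;> constructor <;> linarith
      rw [lam, Measure.restrict_apply m0, this, vol_aff _ _ (by norm_num)]; norm_num
    have k1 : lam ((fun x : ℝ => (1/2) * x + 1/2) ⁻¹' s) = 2 * volume (s ∩ Set.Ico (1/2) 1) := by
      have : (fun x : ℝ => (1/2) * x + 1/2) ⁻¹' s ∩ Set.Ico 0 1 =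
         (fun x : ℝ => (1/2) * x + 1/2) ⁻¹' (s ∩ Set.Ico (1/2) 1) := by
        ext x; simp only [Set.mem_inter_iff, Set.mem_preimage, Set.mem_Ico]
        refine and_congr_right fun _ => ?_
        constructor <;> rintro ⟨_, _⟩ <;> constructor <;> linarith
      rw [lam, Measure.restrict_apply m1, this, vol_aff _ _ (by norm_num)]; norm_num
    have k2 : lam ((fun x : ℝ => 2 * x + 0) ⁻¹' t ∩ Set.Iio (1/2)) = 2⁻¹ * lam t := by
      have : (fun x : ℝ => 2 * x + 0) ⁻¹' t ∩ Set.Iio (1/2) ∩ Set.Ico 0 1 =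
         (fun x : ℝ => 2 * x + 0) ⁻¹' (t ∩ Set.Ico 0 1) := by
        ext x; simp only [Set.mem_inter_iff, Set.mem_preimage, Set.mem_Ico, Set.mem_Iio, and_assoc]
        refine and_congr_right fun _ => ?_
        constructor
        · rintro ⟨_, _, _⟩; constructor <;> linarith
        · rintro ⟨_, _⟩; refine ⟨?_, ?_, ?_⟩ <;> linarith
      rw [lam, Measure.restrict_apply (m2.inter measurableSet_Iio), this, vol_aff _ _ (by norm_num),
        Measure.restrict_apply ht]
      norm_num
      rw [one_div, ENNReal.ofReal_inv_of_pos (by norm_num)]; norm_num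
    have k3 : lam ((fun x : ℝ => 2 * x + (-1)) ⁻¹' t ∩ Set.Ici (1/2)) = 2⁻¹ * lam t := by
      have : (fun x : ℝ => 2 * x + (-1)) ⁻¹' t ∩ Set.Ici (1/2) ∩ Set.Ico 0 1 =
         (fun x : ℝ => 2 * x + (-1)) ⁻¹' (t ∩ Set.Ico 0 1) := by
        ext x; simp only [Set.mem_inter_iff, Set.mem_preimage, Set.mem_Ico, Set.mem_Ici, and_assoc]
        refine and_congr_right fun _ => ?_
        constructor
        · rintro ⟨_, _, _⟩; constructor <;> linarith
        · rintro ⟨_, _⟩; refine ⟨?_, ?_, ?_⟩ <;> linarith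
      rw [lam, Measure.restrict_apply (m3.inter measurableSet_Ici), this, vol_aff _ _ (by norm_num),
        Measure.restrict_apply ht]
      norm_num
      rw [one_div, ENNReal.ofReal_inv_of_pos (by norm_num)]; norm_num
    have k4 : lam s = volume (s ∩ Set.Ico 0 (1/2)) + volume (s ∩ Set.Ico (1/2) 1) := by
      rw [lam, Measure.restrict_apply hs, ← Set.Ico_union_Ico_eq_Ico (b := (1/2:ℝ)) (by norm_num)
        (by norm_num), Set.inter_union_distrib_left, measure_union _ (hs.inter measurableSet_Ico)]
      refine Set.disjoint_left.mpr ?_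
      rintro x ⟨_, h⟩ ⟨_, h'⟩
      exact absurd h.2 (not_lt.mpr h'.1)
    rw [k0, k1, k2, k3, k4, add_mul]
    have h2 : (2:ENNReal) * 2⁻¹ = 1 := ENNReal.mul_inv_cancel (by norm_num) (by norm_num)
    have h3 : ∀ a b : ENNReal, 2 * a * (2⁻¹ * b) = a * b := by
      intro a b
      calc 2 * a * (2⁻¹ * b) = (2 * 2⁻¹) * (a * b) := by ring
        _ = a * b := by rw [h2, one_mul]
    rw [h3, h3]
  · refine Set.disjoint_left.mpr ?_
    rintro x ⟨_, _, h⟩ ⟨_, _, h'⟩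
    exact absurd (Set.mem_Iio.mp h) (not_lt.mpr (Set.mem_Ici.mp h'))

def QQ : Set (ℝ × ℝ) := Set.Ico (0:ℝ) 1 ×ˢ Set.Ico (0:ℝ) 1

lemma ae_QQ : ∀ᵐ w ∂mu, w ∈ QQ := by
  have : mu = (volume.prod volume).restrict QQ := by
    unfold mu lam QQ; rw [Measure.prod_restrict]
  rw [this]
  exact ae_restrict_mem (measurableSet_Ico.prod measurableSet_Ico)

lemma mpi (j : ℕ) : MeasurePreserving (bakerMap^[j]) mu mu := mp.iterate j

noncomputable def DD (t : ℝ) : ℝ := Int.fract (2 * t)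

noncomputable def RR : ℕ → ℝ → ℝ
  | 0, _ => 0
  | m + 1, t => RR m (DD t) + (if t < 1/2 then 0 else (1/2) ^ (m + 1))

lemma DD_meas : Measurable DD := by unfold DD; fun_prop

lemma RR_meas (m : ℕ) : Measurable (RR m) := by
  induction m with
  | zero => exact measurable_const
  | succ m ih =>
    show Measurable (fun t => RR m (DD t) + (if t < 1/2 then 0 else (1/2) ^ (m + 1)))
    exact (ih.comp DD_meas).add
      (Measurable.ite (measurableSet_lt measurable_id measurable_const) measurable_const
        measurable_const)

lemma fract_low (t : ℝ) (h0 : 0 ≤ t) (h1 : t < 1/2) : DD t = 2 * t := by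
  unfold DD; rw [Int.fract_eq_self]; constructor <;> linarith

lemma fract_high (t : ℝ) (h0 : 1/2 ≤ t) (h1 : t < 1) : DD t = 2 * t - 1 := by
  unfold DD; rw [Int.fract_eq_iff]
  exact ⟨by linarith, by linarith, 1, by push_cast; ring⟩

lemma QQ_map (w : ℝ × ℝ) (hw : w ∈ QQ) : bakerMap w ∈ QQ := by
  obtain ⟨⟨h1, h2⟩, h3, h4⟩ := hw
  unfold bakerMap QQ
  split_ifs with h
  · refine ⟨⟨?_, ?_⟩, ?_, ?_⟩ <;> dsimp only <;> linarith
  · refine ⟨⟨?_, ?_⟩, ?_, ?_⟩ <;> dsimp only <;> linarith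

lemma QQ_iter (j : ℕ) (w : ℝ × ℝ) (hw : w ∈ QQ) : bakerMap^[j] w ∈ QQ := by
  induction j with
  | zero => exact hw
  | succ j ih => rw [Function.iterate_succ_apply']; exact QQ_map _ ih

lemma DD_fst (w : ℝ × ℝ) (hw : w ∈ QQ) : DD (bakerMap w).1 = w.1 := by
  obtain ⟨⟨h1, h2⟩, h3, h4⟩ := hw
  unfold bakerMap
  split_ifs with h
  · dsimp only; rw [fract_low _ (by linarith) (by linarith)]; ring
  · dsimp only; rw [fract_high _ (by linarith) (by linarith)]; ring

lemma DD_snd (w : ℝ × ℝ) (hw : w ∈ QQ) : (bakerMap w).2 = DD w.2 := by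
  obtain ⟨⟨h1, h2⟩, h3, h4⟩ := hw
  unfold bakerMap
  split_ifs with h
  · rw [fract_low _ h3 h]
  · rw [fract_high _ (not_lt.mp h) h4]

lemma DD_snd_iter (j : ℕ) (w : ℝ × ℝ) (hw : w ∈ QQ) : (bakerMap^[j] w).2 = DD^[j] w.2 := by
  induction j with
  | zero => rfl
  | succ j ih =>
    rw [Function.iterate_succ_apply', Function.iterate_succ_apply', DD_snd _ (QQ_iter j w hw), ih]

lemma DD_fst_iter (j : ℕ) (w : ℝ × ℝ) (hw : w ∈ QQ) : DD^[j] (bakerMap^[j] w).1 = w.1 := by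
  induction j with
  | zero => rfl
  | succ j ih =>
    rw [Function.iterate_succ_apply, Function.iterate_succ_apply', DD_fst _ (QQ_iter j w hw), ih]

lemma RR_fst (m : ℕ) (w : ℝ × ℝ) (hw : w ∈ QQ) :
    w.2 = RR m (bakerMap^[m] w).1 + (1/2)^m * (bakerMap^[m] w).2 := by
  induction m with
  | zero => simp [RR]
  | succ m ih =>
    have hq := QQ_iter m w hw
    rw [Function.iterate_succ_apply']
    conv_lhs => rw [ih]
    rw [RR, DD_fst _ hq]
    generalize bakerMap^[m] w = v at *
    obtain ⟨⟨h1, h2⟩, h3, h4⟩ := hq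
    unfold bakerMap
    by_cases h : v.2 < 1/2
    · rw [if_pos h, if_pos (by dsimp only; linarith)]; ring
    · rw [if_neg h, if_neg (by dsimp only; linarith)]; ring

lemma RR_snd (m : ℕ) (w : ℝ × ℝ) (hw : w ∈ QQ) :
    (bakerMap^[m] w).1 = RR m w.2 + (1/2)^m * w.1 := by
  induction m generalizing w with
  | zero => simp [RR]
  | succ m ih =>
    rw [Function.iterate_succ_apply, ih _ (QQ_map w hw), RR, DD_snd w hw]
    unfold bakerMap
    by_cases h : w.2 < 1/2
    · rw [if_pos h, if_pos h]; ring
    · rw [if_neg h, if_neg h]; ring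

lemma RR_fst_abs (m : ℕ) (w : ℝ × ℝ) (hw : w ∈ QQ) :
    |w.2 - RR m (bakerMap^[m] w).1| ≤ (1/2)^m := by
  have h := RR_fst m w hw
  obtain ⟨_, h3, h4⟩ := QQ_iter m w hw
  have : w.2 - RR m (bakerMap^[m] w).1 = (1/2)^m * (bakerMap^[m] w).2 := by linarith
  rw [this, abs_of_nonneg (by positivity)]
  exact mul_le_of_le_one_right (by positivity) h4.le

lemma RR_snd_abs (m : ℕ) (w : ℝ × ℝ) (hw : w ∈ QQ) :
    |(bakerMap^[m] w).1 - RR m w.2| ≤ (1/2)^m := by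
  have h := RR_snd m w hw
  obtain ⟨⟨h3, h4⟩, _⟩ := hw
  have : (bakerMap^[m] w).1 - RR m w.2 = (1/2)^m * w.1 := by linarith
  rw [this, abs_of_nonneg (by positivity)]
  exact mul_le_of_le_one_right (by positivity) h4.le

lemma compare (E E' bad : Set (ℝ × ℝ)) (h : ∀ w ∈ QQ, w ∉ bad → (w ∈ E ↔ w ∈ E')) :
    |mu.real E - mu.real E'| ≤ mu.real bad := by
  have key : ∀ A A' : Set (ℝ × ℝ), (∀ w ∈ QQ, w ∉ bad → (w ∈ A ↔ w ∈ A')) →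
      mu.real A ≤ mu.real A' + mu.real bad := by
    intro A A' h
    refine le_trans ?_ (measureReal_union_le A' bad)
    refine ENNReal.toReal_mono (measure_ne_top _ _) (measure_mono_ae ?_)
    filter_upwards [ae_QQ] with w hw hA
    by_cases hb : w ∈ bad
    · exact Or.inr hb
    · exact Or.inl ((h w hw hb).1 hA)
  rw [abs_le]
  have h1 := key E E' h
  have h2 := key E' E (fun w hw hb => (h w hw hb).symm)
  constructor <;> linarith

lemma lam_strip (c r η : ℝ) (hη : 0 ≤ η) : lam.real {t | |(|t - c| - r)| ≤ η} ≤ 4 * η := by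
  have hs : {t | |(|t - c| - r)| ≤ η} ⊆ Set.Icc (c + r - η) (c + r + η) ∪
      Set.Icc (c - r - η) (c - r + η) := by
    intro t ht
    simp only [Set.mem_ofPred_eq, abs_le] at ht
    rcases abs_cases (t - c) with h | h
    · left; constructor <;> linarith [ht.1, ht.2]
    · right; constructor <;> linarith [ht.1, ht.2]
  have hv : ∀ a b : ℝ, a ≤ b → lam.real (Set.Icc a b) ≤ b - a := by
    intro a b hab
    unfold lam
    refine le_trans (ENNReal.toReal_mono ?_ (Measure.restrict_apply_le _ _)) ?_
    · simp
    · simp [hab]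
  calc _ ≤ _ := measureReal_mono hs
    _ ≤ _ := measureReal_union_le _ _
    _ ≤ _ := add_le_add (hv _ _ (by linarith)) (hv _ _ (by linarith))
    _ = _ := by ring

lemma mu_fst (S : Set ℝ) : mu.real {w | w.1 ∈ S} = lam.real S := by
  have : {w : ℝ × ℝ | w.1 ∈ S} = S ×ˢ Set.univ := by ext; simp
  rw [this, mu, measureReal_prod_prod]; simp

lemma mu_snd (S : Set ℝ) : mu.real {w | w.2 ∈ S} = lam.real S := by
  have : {w : ℝ × ℝ | w.2 ∈ S} = Set.univ ×ˢ S := by ext; simp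
  rw [this, mu, measureReal_prod_prod]; simp

lemma mu_pre (j : ℕ) (S : Set (ℝ × ℝ)) (hS : MeasurableSet S) :
    mu.real {w | bakerMap^[j] w ∈ S} = mu.real S := by
  unfold Measure.real
  rw [← (mpi j).measure_preimage hS.nullMeasurableSet]; rfl

def BB (z : ℝ × ℝ) (r : ℝ) : Set (ℝ × ℝ) := {v | |v.1 - z.1| < r ∧ |v.2 - z.2| < r}
def WW (z : ℝ × ℝ) (r : ℝ) (N : ℕ) : Set (ℝ × ℝ) := {w | ∀ j < N, bakerMap^[j] w ∉ BB z r}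

lemma BB_meas (z : ℝ × ℝ) (r : ℝ) : MeasurableSet (BB z r) := by
  exact (measurableSet_lt ((measurable_fst.sub_const z.1).abs) measurable_const).inter
    (measurableSet_lt ((measurable_snd.sub_const z.2).abs) measurable_const)

lemma iter_meas (j : ℕ) : Measurable (bakerMap^[j]) := baker_meas.iterate j

lemma WW_meas (z : ℝ × ℝ) (r : ℝ) (N : ℕ) : MeasurableSet (WW z r N) := by
  have : WW z r N = ⋂ j, ⋂ (_ : j < N), (bakerMap^[j] ⁻¹' (BB z r))ᶜ := by
    ext; simp [WW]
  rw [this]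
  exact MeasurableSet.iInter fun j => MeasurableSet.iInter fun _ =>
    ((iter_meas j) (BB_meas z r)).compl

lemma iff_of_close (a b c r η : ℝ) (h : |a - b| ≤ η) (hn : ¬ |(|a - c| - r)| ≤ η) :
    (|a - c| < r ↔ |b - c| < r) := by
  have h1 : |(|a - c| - |b - c|)| ≤ η := by
    refine le_trans (abs_abs_sub_abs_le _ _) ?_
    simpa using h
  rw [not_le, lt_abs] at hn
  rw [abs_le] at h1
  constructor <;> intro h <;> rcases hn with hn | hn <;> linarith [h1.1, h1.2]

def strip (c r η : ℝ) : Set ℝ := {t | |(|t - c| - r)| ≤ η}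

lemma strip_meas (c r η : ℝ) : MeasurableSet (strip c r η) := by
  unfold strip; exact measurableSet_le (by fun_prop) measurable_const

lemma decouple (z : ℝ × ℝ) (r : ℝ) (l m N : ℕ) :
    |mu.real (WW z r l ∩ {w | bakerMap^[l + 2 * m] w ∈ WW z r N})
      - mu.real (WW z r l) * mu.real (WW z r N)| ≤ 8 * (l + N) * (1/2)^m := by
  set η : ℝ := (1/2)^m with hη
  have hη0 : 0 ≤ η := by positivity
  let S : Set ℝ := {t | ∀ j < l, ¬ (|DD^[l + m - j] t - z.1| < r ∧ |RR m (DD^[l - j] t) - z.2| < r)}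
  let G : Set ℝ := {t | ∀ j < N, ¬ (|RR m (DD^[j] t) - z.1| < r ∧ |DD^[j + m] t - z.2| < r)}
  have hS : MeasurableSet S := by
    have : S = ⋂ j, ⋂ (_ : j < l), ({t | |DD^[l + m - j] t - z.1| < r} ∩
      {t | |RR m (DD^[l - j] t) - z.2| < r})ᶜ := by
      ext; simp [S]
    rw [this]
    refine MeasurableSet.iInter fun j => MeasurableSet.iInter fun _ => (MeasurableSet.inter ?_ ?_).compl
    · exact measurableSet_lt (((DD_meas.iterate _).sub_const _).abs) measurable_const
    · exact measurableSet_lt ((((RR_meas m).comp (DD_meas.iterate _)).sub_const _).abs) measurable_const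
  have hG : MeasurableSet G := by
    have : G = ⋂ j, ⋂ (_ : j < N), ({t | |RR m (DD^[j] t) - z.1| < r} ∩
      {t | |DD^[j + m] t - z.2| < r})ᶜ := by
      ext; simp [G]
    rw [this]
    refine MeasurableSet.iInter fun j => MeasurableSet.iInter fun _ => (MeasurableSet.inter ?_ ?_).compl
    · exact measurableSet_lt ((((RR_meas m).comp (DD_meas.iterate _)).sub_const _).abs) measurable_const
    · exact measurableSet_lt (((DD_meas.iterate _).sub_const _).abs) measurable_const
  let bad1 : Set (ℝ × ℝ) := ⋃ j ∈ Finset.range l, {w | bakerMap^[j] w ∈ {v : ℝ × ℝ | v.2 ∈ strip z.2 r η}}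
  let bad2 : Set (ℝ × ℝ) := ⋃ j ∈ Finset.range N, {w | bakerMap^[j + m] w ∈ {v : ℝ × ℝ | v.1 ∈ strip z.1 r η}}
  have hb1 : mu.real bad1 ≤ l * (4 * η) := by
    refine (measureReal_biUnion_finset_le _ _).trans ?_
    refine (Finset.sum_le_card_nsmul _ _ (4 * η) fun j _ => ?_).trans (by simp)
    rw [mu_pre _ {v : ℝ × ℝ | v.2 ∈ strip z.2 r η} (measurable_snd (strip_meas _ _ _)), mu_snd]
    exact lam_strip _ _ _ hη0
  have hb2 : mu.real bad2 ≤ N * (4 * η) := by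
    refine (measureReal_biUnion_finset_le _ _).trans ?_
    refine (Finset.sum_le_card_nsmul _ _ (4 * η) fun j _ => ?_).trans (by simp)
    rw [mu_pre _ {v : ℝ × ℝ | v.1 ∈ strip z.1 r η} (measurable_fst (strip_meas _ _ _)), mu_fst]
    exact lam_strip _ _ _ hη0
  have mb2 : MeasurableSet bad2 := by
    refine Finset.measurableSet_biUnion _ fun j _ => ?_
    exact iter_meas _ (measurable_fst (strip_meas _ _ _))
  have h1 : ∀ w ∈ QQ, w ∉ bad1 →
      (w ∈ WW z r l ↔ w ∈ {w | bakerMap^[l + m] w ∈ {v : ℝ × ℝ | v.1 ∈ S}}) := by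
    intro w hw hb
    change (∀ j < l, bakerMap^[j] w ∉ BB z r) ↔ (∀ j < l, _)
    refine forall₂_congr fun j hj => not_congr ?_
    have hq := QQ_iter j w hw
    have e1 : DD^[l + m - j] (bakerMap^[l + m] w).1 = (bakerMap^[j] w).1 := by
      have := DD_fst_iter (l + m - j) _ hq
      rwa [← Function.iterate_add_apply, Nat.sub_add_cancel (by omega)] at this
    have e2 : DD^[l - j] (bakerMap^[l + m] w).1 = (bakerMap^[m] (bakerMap^[j] w)).1 := by
      have := DD_fst_iter (l - j) _ (QQ_iter m _ hq)
      rwa [← Function.iterate_add_apply, ← Function.iterate_add_apply,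
        show l - j + m + j = l + m by omega] at this
    rw [e1, e2]
    refine and_congr_right fun _ => ?_
    refine iff_of_close _ _ _ _ η (RR_fst_abs m _ hq) ?_
    intro hh
    exact hb (Set.mem_biUnion (Finset.mem_coe.mpr (Finset.mem_range.mpr hj)) hh)
  have h2 : ∀ w ∈ QQ, w ∉ bad2 →
      (w ∈ {w | bakerMap^[m] w ∈ WW z r N} ↔ w ∈ {v : ℝ × ℝ | v.2 ∈ G}) := by
    intro w hw hb
    change (∀ j < N, bakerMap^[j] (bakerMap^[m] w) ∉ BB z r) ↔ (∀ j < N, _)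
    refine forall₂_congr fun j hj => not_congr ?_
    have hq := QQ_iter j w hw
    have e1 : DD^[j + m] w.2 = (bakerMap^[j] (bakerMap^[m] w)).2 := by
      rw [← DD_snd_iter _ _ hw, Function.iterate_add_apply]
    have e2 : DD^[j] w.2 = (bakerMap^[j] w).2 := by
      rw [← DD_snd_iter _ _ hw]
    rw [e1, e2]
    refine and_congr_left fun _ => ?_
    have := RR_snd_abs m _ hq
    rw [← Function.iterate_add_apply, add_comm, Function.iterate_add_apply] at this
    refine iff_of_close _ _ _ _ η this ?_
    intro hh
    refine hb (Set.mem_biUnion (Finset.mem_coe.mpr (Finset.mem_range.mpr hj)) ?_)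
    change (bakerMap^[j + m] w).1 ∈ strip z.1 r η
    rw [Function.iterate_add_apply]; exact hh
  have c1 := compare _ _ _ h1
  have c2 := compare _ _ _ h2
  rw [mu_pre _ {v : ℝ × ℝ | v.1 ∈ S} (measurable_fst hS), mu_fst] at c1
  rw [mu_pre _ _ (WW_meas z r N), mu_snd] at c2
  have c3 := compare (WW z r l ∩ {w | bakerMap^[l + 2 * m] w ∈ WW z r N})
    {w | bakerMap^[l + m] w ∈ S ×ˢ G} (bad1 ∪ {w | bakerMap^[l + m] w ∈ bad2}) (by
      intro w hw hb
      have hb1 : w ∉ bad1 := fun h => hb (Or.inl h)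
      have hb2 : bakerMap^[l + m] w ∉ bad2 := fun h => hb (Or.inr h)
      have k1 := h1 w hw hb1
      have k2 := h2 _ (QQ_iter _ w hw) hb2
      change _ ∧ bakerMap^[l + 2 * m] w ∈ WW z r N ↔ _ ∧ _
      rw [show l + 2 * m = m + (l + m) by ring, Function.iterate_add_apply]
      exact and_congr k1 k2)
  rw [mu_pre _ _ (hS.prod hG)] at c3
  have e : mu.real (S ×ˢ G) = lam.real S * lam.real G := by rw [mu, measureReal_prod_prod]
  have hb3 : mu.real (bad1 ∪ {w | bakerMap^[l + m] w ∈ bad2}) ≤ l * (4 * η) + N * (4 * η) := by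
    refine (measureReal_union_le _ _).trans ?_
    rw [mu_pre _ _ mb2]; linarith
  rw [e] at c3
  have p1 : lam.real S ≤ 1 := measureReal_le_one
  have p2 : mu.real (WW z r N) ≤ 1 := measureReal_le_one
  have p3 : 0 ≤ lam.real S := measureReal_nonneg
  have p4 : 0 ≤ mu.real (WW z r N) := measureReal_nonneg
  have c4 : |lam.real S * lam.real G - mu.real (WW z r l) * mu.real (WW z r N)| ≤
      l * (4 * η) + N * (4 * η) := by
    have : lam.real S * lam.real G - mu.real (WW z r l) * mu.real (WW z r N) =
      lam.real S * -(mu.real (WW z r N) - lam.real G) +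
        -(mu.real (WW z r l) - lam.real S) * mu.real (WW z r N) := by ring
    rw [this]
    refine (abs_add_le _ _).trans ?_
    rw [abs_mul, abs_mul, abs_neg, abs_neg, abs_of_nonneg p3, abs_of_nonneg p4]
    have q1 := mul_le_of_le_one_left (abs_nonneg (mu.real (WW z r N) - lam.real G)) p1
    have q2 := mul_le_of_le_one_right (abs_nonneg (mu.real (WW z r l) - lam.real S)) p2
    linarith
  refine (abs_sub_le _ (lam.real S * lam.real G) _).trans ?_
  refine (add_le_add (c3.trans hb3) c4).trans (le_of_eq ?_)
  ring

lemma hits_le (z : ℝ × ℝ) (r : ℝ) (l g : ℕ) :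
    mu.real (⋃ j ∈ Finset.range g, {w | bakerMap^[l + j] w ∈ BB z r}) ≤ g * mu.real (BB z r) := by
  refine (measureReal_biUnion_finset_le _ _).trans ?_
  refine (Finset.sum_le_card_nsmul _ _ (mu.real (BB z r)) fun j _ => ?_).trans (by simp)
  rw [mu_pre _ _ (BB_meas z r)]

lemma step1 (z : ℝ × ℝ) (r : ℝ) (l g N : ℕ) :
    |mu.real (WW z r (l + g + N)) -
      mu.real (WW z r l ∩ {w | bakerMap^[l + g] w ∈ WW z r N})| ≤ g * mu.real (BB z r) := by
  refine (compare _ _ (⋃ j ∈ Finset.range g, {w | bakerMap^[l + j] w ∈ BB z r}) ?_).trans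
    (hits_le z r l g)
  intro w hw hb
  have hb' : ∀ j < g, bakerMap^[l + j] w ∉ BB z r := fun j hj h =>
    hb (Set.mem_biUnion (Finset.mem_coe.mpr (Finset.mem_range.mpr hj)) h)
  change (∀ j < l + g + N, bakerMap^[j] w ∉ BB z r) ↔ (∀ j < l, bakerMap^[j] w ∉ BB z r) ∧
    (∀ j < N, bakerMap^[j] (bakerMap^[l + g] w) ∉ BB z r)
  simp only [← Function.iterate_add_apply]
  constructor
  · intro h
    exact ⟨fun j hj => h j (by omega), fun j hj => h _ (by omega)⟩
  · rintro ⟨h1, h2⟩ j hj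
    by_cases c1 : j < l
    · exact h1 j c1
    · by_cases c2 : j < l + g
      · have := hb' (j - l) (by omega)
        rwa [show l + (j - l) = j by omega] at this
      · have := h2 (j - (l + g)) (by omega)
        rwa [show j - (l + g) + (l + g) = j by omega] at this

lemma step2 (z : ℝ × ℝ) (r : ℝ) (l m N : ℕ) :
    |mu.real (WW z r (l + 2 * m + N)) - mu.real (WW z r l) * mu.real (WW z r N)| ≤
      2 * m * mu.real (BB z r) + 8 * (l + N) * (1/2)^m := by
  refine (abs_sub_le _ _ _).trans (add_le_add ((step1 z r l (2 * m) N).trans ?_) (decouple z r l m N))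
  push_cast; rfl

lemma tail_le (z : ℝ × ℝ) (r : ℝ) (l g : ℕ) :
    |mu.real (WW z r (l + g)) - mu.real (WW z r l)| ≤ g * mu.real (BB z r) := by
  have := step1 z r l g 0
  have e : WW z r l ∩ {w | bakerMap^[l + g] w ∈ WW z r 0} = WW z r l := by
    ext; simp [WW]
  rwa [e] at this

lemma blocks (z : ℝ × ℝ) (r : ℝ) (l m M k : ℕ) (h : k * (l + 2 * m) ≤ M) :
    |mu.real (WW z r (k * (l + 2 * m))) - mu.real (WW z r l) ^ k| ≤
      k * (2 * m * mu.real (BB z r) + 8 * M * (1/2)^m) := by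
  induction k with
  | zero =>
    have : WW z r (0 * (l + 2 * m)) = Set.univ := by ext; simp [WW]
    rw [this]; simp
  | succ k ih =>
    have hk : (k + 1) * (l + 2 * m) = l + 2 * m + k * (l + 2 * m) := by ring
    have ih := ih (by omega)
    have s := step2 z r l m (k * (l + 2 * m))
    rw [hk]
    have hM : (l : ℝ) + (k * (l + 2 * m) : ℕ) ≤ M := by
      exact_mod_cast (by omega : l + k * (l + 2 * m) ≤ M)
    have s' : 8 * ((l : ℝ) + (k * (l + 2 * m) : ℕ)) * (1/2)^m ≤ 8 * M * (1/2)^m := by gcongr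
    have p1 : mu.real (WW z r l) ≤ 1 := measureReal_le_one
    have p3 : 0 ≤ mu.real (WW z r l) := measureReal_nonneg
    refine (abs_sub_le _ (mu.real (WW z r l) * mu.real (WW z r (k * (l + 2 * m)))) _).trans ?_
    rw [pow_succ', ← mul_sub, abs_mul, abs_of_nonneg p3]
    have := mul_le_of_le_one_left (abs_nonneg (mu.real (WW z r (k * (l + 2 * m))) - mu.real (WW z r l) ^ k)) p1
    push_cast at *
    linarith

lemma incr (z : ℝ × ℝ) (r : ℝ) (l : ℕ) :
    mu.real (WW z r l) - mu.real (WW z r (l + 1)) =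
      mu.real (BB z r ∩ {w | bakerMap^[1] w ∈ WW z r l}) := by
  have h := mu_pre 1 _ (WW_meas z r l)
  have h2 := measureReal_inter_add_sdiff (μ := mu) (s := {w | bakerMap^[1] w ∈ WW z r l}) (BB_meas z r)
  have e : WW z r (l + 1) = {w | bakerMap^[1] w ∈ WW z r l} \ BB z r := by
    ext w
    change (∀ j < l + 1, bakerMap^[j] w ∉ BB z r) ↔
      (∀ j < l, bakerMap^[j] (bakerMap^[1] w) ∉ BB z r) ∧ bakerMap^[0] w ∉ BB z r
    simp only [← Function.iterate_add_apply]
    constructor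
    · intro h
      exact ⟨fun j hj => h _ (by omega), h _ (by omega)⟩
    · rintro ⟨h1, h2⟩ j hj
      rcases j with _ | j
      · exact h2
      · exact h1 j (by omega)
  rw [e, Set.inter_comm]
  linarith

lemma upper (z : ℝ × ℝ) (r : ℝ) (p : ℕ) (hp : 1 ≤ p) (l : ℕ) :
    1 - mu.real (WW z r l) ≤ l * mu.real (BB z r \ {w | bakerMap^[p] w ∈ BB z r})
      + p * mu.real (BB z r) := by
  have key : ∀ l, 1 - mu.real (WW z r l) ≤ l * mu.real (BB z r \ {w | bakerMap^[p] w ∈ BB z r})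
      + (min l p : ℕ) * mu.real (BB z r) := by
    intro l
    induction l with
    | zero =>
      have : WW z r 0 = Set.univ := by ext; simp [WW]
      rw [this]; simp
    | succ l ih =>
      have i := incr z r l
      have hA : 0 ≤ mu.real (BB z r \ {w | bakerMap^[p] w ∈ BB z r}) := measureReal_nonneg
      by_cases h : p ≤ l
      · have : mu.real (BB z r ∩ {w | bakerMap^[1] w ∈ WW z r l}) ≤
          mu.real (BB z r \ {w | bakerMap^[p] w ∈ BB z r}) := by
          refine measureReal_mono ?_
          rintro w ⟨h1, h2⟩
          refine ⟨h1, fun h3 => h2 (p - 1) (by omega) ?_⟩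
          rw [← Function.iterate_add_apply, Nat.sub_add_cancel hp]; exact h3
        rw [min_eq_right h] at ih
        rw [min_eq_right (by omega)]
        push_cast; linarith
      · have : mu.real (BB z r ∩ {w | bakerMap^[1] w ∈ WW z r l}) ≤ mu.real (BB z r) :=
          measureReal_mono Set.inter_subset_left
        rw [min_eq_left (by omega)] at ih
        rw [min_eq_left (by omega)]
        push_cast; linarith
  refine (key l).trans ?_
  have : 0 ≤ mu.real (BB z r) := measureReal_nonneg
  gcongr
  exact min_le_right _ _

lemma lower (z : ℝ × ℝ) (r : ℝ) (p N l : ℕ) (hr : 0 ≤ r)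
    (hN : ∀ i, 1 ≤ i → i ≤ N → ∀ w ∈ BB z r, bakerMap^[p] w ∉ BB z r → bakerMap^[i] w ∉ BB z r)
    (hpair : ∀ i, mu.real (BB z r ∩ {w | bakerMap^[i] w ∈ BB z r}) ≤
      4 * r^2 * (2 * r + 2 * (1/2)^i)) :
    l * (mu.real (BB z r \ {w | bakerMap^[p] w ∈ BB z r}) - 4 * r^2 * (2 * r * l + 2 * (1/2)^N))
     ≤ 1 - mu.real (WW z r l) := by
  set A := BB z r \ {w | bakerMap^[p] w ∈ BB z r} with hA
  have sumb : ∀ q : ℕ, ∑ i ∈ Finset.range q, 4 * r^2 * (2 * r + 2 * (1/2:ℝ)^(N + 1 + i)) ≤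
      4 * r^2 * (2 * r * q + 2 * ((1/2)^N - (1/2)^(N + q))) := by
    intro q
    induction q with
    | zero => simp
    | succ q ih =>
      rw [Finset.sum_range_succ]
      refine (add_le_add_left ih _).trans (le_of_eq ?_)
      push_cast; ring
  have inc : ∀ q ≤ l, mu.real A - 4 * r^2 * (2 * r * l + 2 * (1/2)^N) ≤
      mu.real (BB z r ∩ {w | bakerMap^[1] w ∈ WW z r q}) := by
    intro q hq
    have hsub : A ⊆ (BB z r ∩ {w | bakerMap^[1] w ∈ WW z r q}) ∪
        ⋃ i ∈ Finset.range q, (BB z r ∩ {w | bakerMap^[N + 1 + i] w ∈ BB z r}) := by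
      rintro w ⟨h1, h2⟩
      by_cases hw : bakerMap^[1] w ∈ WW z r q
      · exact Or.inl ⟨h1, hw⟩
      · right
        unfold WW at hw
        simp only [Set.mem_ofPred_eq, not_forall, not_not, ← Function.iterate_add_apply] at hw
        obtain ⟨j, hj, hj2⟩ := hw
        have : N < j + 1 := by
          by_contra hc
          exact hN (j + 1) (by omega) (by omega) w h1 h2 hj2
        refine Set.mem_biUnion (x := j - N) (Finset.mem_coe.mpr (Finset.mem_range.mpr (by omega))) ⟨h1, ?_⟩
        change bakerMap^[N + 1 + (j - N)] w ∈ BB z r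
        rwa [show N + 1 + (j - N) = j + 1 by omega]
    have h1 := (measureReal_mono (μ := mu) hsub).trans (measureReal_union_le _ _)
    have h2 := (measureReal_biUnion_finset_le (μ := mu) (Finset.range q)
      (fun i => BB z r ∩ {w | bakerMap^[N + 1 + i] w ∈ BB z r})).trans
      ((Finset.sum_le_sum fun i _ => hpair (N + 1 + i)).trans (sumb q))
    have h3 : 4 * r^2 * (2 * r * q + 2 * ((1/2)^N - (1/2)^(N + q))) ≤
       4 * r^2 * (2 * r * l + 2 * (1/2)^N) := by
      have : (q : ℝ) ≤ l := by exact_mod_cast hq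
      have h4 : (0:ℝ) ≤ (1/2)^(N + q) := by positivity
      gcongr
      linarith
    linarith
  have key : ∀ q ≤ l, q * (mu.real A - 4 * r^2 * (2 * r * l + 2 * (1/2)^N)) ≤
      1 - mu.real (WW z r q) := by
    intro q
    induction q with
    | zero =>
      have : WW z r 0 = Set.univ := by ext; simp [WW]
      rw [this]; simp
    | succ q ih =>
      intro hq
      have i1 := ih (by omega)
      have i2 := inc q (by omega)
      rw [← incr] at i2
      push_cast; linarith
  exact key l le_rfl

lemma snd_int (i : ℕ) (w : ℝ × ℝ) : ∃ k : ℤ, (bakerMap^[i] w).2 = 2^i * w.2 - k := by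
  induction i with
  | zero => exact ⟨0, by simp⟩
  | succ i ih =>
    obtain ⟨k, hk⟩ := ih
    rw [Function.iterate_succ_apply', bakerMap]
    split_ifs
    · refine ⟨2 * k, ?_⟩
      dsimp only; rw [hk]; push_cast; ring
    · refine ⟨2 * k + 1, ?_⟩
      dsimp only; rw [hk]; push_cast; ring

lemma snd_ne_half (z : ℝ × ℝ) (hy : Nondyadic z.2) (i : ℕ) : (bakerMap^[i] z).2 ≠ 1/2 := by
  intro h
  obtain ⟨k, hk⟩ := snd_int i z
  apply hy (2 * k + 1) (i + 1)
  rw [h] at hk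
  rw [eq_div_iff (by positivity)]
  push_cast
  rw [pow_succ]; linarith

lemma lin (z : ℝ × ℝ) (hy : Nondyadic z.2) (i : ℕ) :
    ∃ ρ > 0, ∀ w : ℝ × ℝ, |w.2 - z.2| < ρ →
      bakerMap^[i] w = ((bakerMap^[i] z).1 + (1/2)^i * (w.1 - z.1),
        (bakerMap^[i] z).2 + 2^i * (w.2 - z.2)) := by
  induction i with
  | zero => exact ⟨1, one_pos, fun w _ => by ext <;> simp⟩
  | succ i ih =>
    obtain ⟨ρ, hρ, h⟩ := ih
    have hne := snd_ne_half z hy i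
    have hpos : 0 < |(bakerMap^[i] z).2 - 1/2| := abs_pos.mpr (sub_ne_zero.mpr hne)
    refine ⟨min ρ (|(bakerMap^[i] z).2 - 1/2| / 2^i), by positivity, fun w hw => ?_⟩
    have h1 := h w (lt_of_lt_of_le hw (min_le_left _ _))
    have h2 := lt_of_lt_of_le hw (min_le_right _ _)
    rw [lt_div_iff₀ (by positivity)] at h2
    have h3 : |2^i * (w.2 - z.2)| < |(bakerMap^[i] z).2 - 1/2| := by
      rw [abs_mul, abs_of_nonneg (by positivity : (0:ℝ) ≤ 2^i), mul_comm]; exact h2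
    rw [Function.iterate_succ_apply', Function.iterate_succ_apply', h1]
    generalize bakerMap^[i] z = v at *
    have h4 := abs_lt.mp h3
    unfold bakerMap
    by_cases c : v.2 < 1/2
    · rw [abs_of_neg (by linarith : v.2 - 1/2 < 0)] at h4
      rw [if_pos c, if_pos (by dsimp only; linarith [h4.2])]
      ext <;> dsimp only <;> ring
    · rw [abs_of_nonneg (by linarith : 0 ≤ v.2 - 1/2)] at h4
      rw [if_neg c, if_neg (by dsimp only; linarith [h4.1])]
      ext <;> dsimp only <;> ring

lemma lam_int_le (c s : ℝ) (hs : 0 ≤ s) : lam.real {t | |t - c| < s} ≤ 2 * s := by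
  have : {t | |t - c| < s} = Set.Ioo (c - s) (c + s) := by
    ext t; simp only [Set.mem_ofPred_eq, abs_lt, Set.mem_Ioo]
    constructor <;> rintro ⟨_, _⟩ <;> constructor <;> linarith
  rw [this]
  unfold lam
  refine le_trans (ENNReal.toReal_mono ?_ (Measure.restrict_apply_le _ _)) ?_
  · simp
  · rw [Real.volume_Ioo, ENNReal.toReal_ofReal] <;> linarith

lemma lam_int_eq (c s : ℝ) (hs : 0 ≤ s) (h0 : 0 ≤ c - s) (h1 : c + s ≤ 1) :
    lam.real {t | |t - c| < s} = 2 * s := by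
  have : {t | |t - c| < s} = Set.Ioo (c - s) (c + s) := by
    ext t; simp only [Set.mem_ofPred_eq, abs_lt, Set.mem_Ioo]
    constructor <;> rintro ⟨_, _⟩ <;> constructor <;> linarith
  rw [this]
  unfold lam Measure.real
  rw [Measure.restrict_apply measurableSet_Ioo, Set.inter_eq_left.mpr, Real.volume_Ioo,
    ENNReal.toReal_ofReal] 
  · ring
  · linarith
  · rintro t ⟨_, _⟩; constructor <;> linarith

lemma mu_rect (c d s t : ℝ) :
    mu.real {v : ℝ × ℝ | |v.1 - c| < s ∧ |v.2 - d| < t} =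
      lam.real {x | |x - c| < s} * lam.real {x | |x - d| < t} := by
  have : {v : ℝ × ℝ | |v.1 - c| < s ∧ |v.2 - d| < t} =
    {x | |x - c| < s} ×ˢ {x | |x - d| < t} := rfl
  rw [this, mu, measureReal_prod_prod]

lemma pair (z : ℝ × ℝ) (r : ℝ) (hr : 0 ≤ r) (i : ℕ) :
    mu.real (BB z r ∩ {w | bakerMap^[i] w ∈ BB z r}) ≤ 4 * r^2 * (2 * r + 2 * (1/2)^i) := by
  let K : Finset ℤ := Finset.Ioc ⌊2^i * (z.2 - r) - 1⌋ ⌊2^i * (z.2 + r)⌋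
  let S : Set ℝ := ⋃ k ∈ K, {t | |t - (k + z.2) / 2^i| < r / 2^i}
  have h1 : mu.real (BB z r ∩ {w | bakerMap^[i] w ∈ BB z r}) ≤
      mu.real ({x | |x - z.1| < r} ×ˢ S) := by
    refine ENNReal.toReal_mono (measure_ne_top _ _) (measure_mono_ae ?_)
    filter_upwards [ae_QQ] with w hw hA
    obtain ⟨⟨a1, a2⟩, a3, a4⟩ := hA
    refine ⟨a1, ?_⟩
    obtain ⟨k, hk⟩ := snd_int i w
    obtain ⟨_, q1, q2⟩ := QQ_iter i w hw
    have p2 : (0:ℝ) < 2^i := by positivity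
    rw [abs_lt] at a2
    have b1 : (2:ℝ)^i * (z.2 - r) < 2^i * w.2 := by gcongr; linarith
    have b2 : (2:ℝ)^i * w.2 < 2^i * (z.2 + r) := by gcongr; linarith
    refine Set.mem_biUnion (x := k) ?_ ?_
    · refine Finset.mem_coe.mpr (Finset.mem_Ioc.mpr ⟨?_, ?_⟩)
      · rw [Int.floor_lt]; linarith
      · rw [Int.le_floor]; linarith
    · change |w.2 - (k + z.2) / 2^i| < r / 2^i
      rw [hk] at a4
      rw [lt_div_iff₀ p2, ← abs_of_pos p2, ← abs_mul, abs_of_pos p2]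
      have e : (w.2 - (k + z.2) / 2^i) * 2^i = 2^i * w.2 - k - z.2 := by
        rw [sub_mul, div_mul_cancel₀ _ p2.ne']; ring
      rwa [e]
  refine h1.trans ?_
  rw [mu, measureReal_prod_prod]
  have hS : lam.real S ≤ (2^i * (2 * r) + 2) * (2 * (r / 2^i)) := by
    refine (measureReal_biUnion_finset_le _ _).trans ?_
    refine (Finset.sum_le_card_nsmul _ _ (2 * (r / 2^i)) fun j _ => lam_int_le _ _ (by positivity)).trans ?_
    rw [nsmul_eq_mul]
    gcongr
    simp only [K, Int.card_Ioc]
    have h0 : (2:ℝ)^i * (z.2 - r) ≤ 2^i * (z.2 + r) := by gcongr; linarith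
    have h2 : (((⌊2^i * (z.2 + r)⌋ - ⌊2^i * (z.2 - r) - 1⌋).toNat : ℤ) : ℝ) ≤ 2^i * (2 * r) + 2 := by
      rw [Int.toNat_of_nonneg (sub_nonneg.mpr (Int.floor_mono (by linarith)))]
      push_cast
      have := Int.floor_le ((2:ℝ)^i * (z.2 + r))
      have := Int.lt_floor_add_one ((2:ℝ)^i * (z.2 - r) - 1)
      push_cast at *
      linarith
    exact_mod_cast h2
  calc _ ≤ (2 * r) * ((2^i * (2 * r) + 2) * (2 * (r / 2^i))) :=
        mul_le_mul (lam_int_le _ _ hr) hS measureReal_nonneg (by positivity)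
    _ = _ := by
      rw [one_div, inv_pow]; field_simp; ring

lemma geom (z : ℝ × ℝ) (hz : z ∈ Set.Ioo (0:ℝ) 1 ×ˢ Set.Ioo (0:ℝ) 1)
    (hy : Nondyadic z.2) (p : ℕ)
    (hper : bakerMap^[p] z = z) :
    ∀ᶠ r in 𝓝[>] (0:ℝ), mu.real (BB z r) = 4 * r^2 ∧
      mu.real (BB z r \ {w | bakerMap^[p] w ∈ BB z r}) = (1 - (1/2)^p) * (4 * r^2) := by
  obtain ⟨ρ, hρ, h⟩ := lin z hy p
  obtain ⟨⟨z1, z2⟩, z3, z4⟩ := hz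
  have hev : ∀ c : ℝ, 0 < c → ∀ᶠ r in 𝓝[>] (0:ℝ), r < c := fun c hc =>
    mem_nhdsWithin_of_mem_nhds (Iio_mem_nhds hc)
  filter_upwards [hev ρ hρ, hev z.1 z1, hev (1 - z.1) (by linarith), hev z.2 z3,
    hev (1 - z.2) (by linarith), self_mem_nhdsWithin] with r r1 r2 r3 r4 r5 r0
  have r0 : 0 < r := r0
  have e1 : mu.real (BB z r) = 4 * r^2 := by
    rw [BB, mu_rect, lam_int_eq _ _ r0.le (by linarith) (by linarith),
      lam_int_eq _ _ r0.le (by linarith) (by linarith)]; ring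
  have hle : r / 2^p ≤ r := div_le_self r0.le (one_le_pow₀ (by norm_num))
  have e2 : BB z r ∩ {w | bakerMap^[p] w ∈ BB z r} =
      {v : ℝ × ℝ | |v.1 - z.1| < r ∧ |v.2 - z.2| < r / 2^p} := by
    ext w
    change (|w.1 - z.1| < r ∧ |w.2 - z.2| < r) ∧ (|(bakerMap^[p] w).1 - z.1| < r ∧
      |(bakerMap^[p] w).2 - z.2| < r) ↔ |w.1 - z.1| < r ∧ |w.2 - z.2| < r / 2^p
    have key : |w.2 - z.2| < r → (bakerMap^[p] w).1 - z.1 = (1/2)^p * (w.1 - z.1) ∧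
       (bakerMap^[p] w).2 - z.2 = 2^p * (w.2 - z.2) := by
      intro hw
      rw [h w (hw.trans r1), hper]
      constructor <;> dsimp only <;> ring
    have e3 : |2^p * (w.2 - z.2)| = |w.2 - z.2| * 2^p := by
      rw [abs_mul, abs_of_pos (by positivity : (0:ℝ) < 2^p), mul_comm]
    rw [lt_div_iff₀ (by positivity)]
    constructor
    · rintro ⟨⟨a1, a2⟩, a3, a4⟩
      refine ⟨a1, ?_⟩
      rwa [(key a2).2, e3] at a4
    · rintro ⟨a1, a2⟩
      have a3 : |w.2 - z.2| < r := by
        refine lt_of_le_of_lt ?_ a2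
        exact le_mul_of_one_le_right (abs_nonneg _) (one_le_pow₀ (by norm_num))
      refine ⟨⟨a1, a3⟩, ?_, ?_⟩
      · rw [(key a3).1, abs_mul, abs_of_pos (by positivity : (0:ℝ) < (1/2)^p)]
        refine lt_of_le_of_lt ?_ a1
        exact mul_le_of_le_one_left (abs_nonneg _) (pow_le_one₀ (by norm_num) (by norm_num))
      · rwa [(key a3).2, e3]
  refine ⟨e1, ?_⟩
  have h2 := measureReal_inter_add_sdiff (μ := mu) (s := BB z r)
    (t := {w | bakerMap^[p] w ∈ BB z r}) ((iter_meas p) (BB_meas z r))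
  rw [e2, mu_rect, lam_int_eq _ _ r0.le (by linarith) (by linarith),
      lam_int_eq _ _ (by positivity) (by linarith) (by linarith), e1] at h2
  have h3 : 2 * r * (2 * (r / 2^p)) = (1/2)^p * (4 * r^2) := by
    rw [one_div, inv_pow]; field_simp; ring
  rw [h3] at h2
  linarith

lemma geom2 (z : ℝ × ℝ) 
    (hy : Nondyadic z.2) (p : ℕ) (hp : 1 ≤ p)
    (hper : bakerMap^[p] z = z)
    (hmin : ∀ j, 1 ≤ j → j < p → bakerMap^[j] z ≠ z) (N : ℕ) :
    ∀ᶠ r in 𝓝[>] (0:ℝ), ∀ i, 1 ≤ i → i ≤ N →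
      ∀ w ∈ BB z r, bakerMap^[p] w ∉ BB z r → bakerMap^[i] w ∉ BB z r := by
  obtain ⟨ρp, hρp, hlp⟩ := lin z hy p
  have hev : ∀ c : ℝ, 0 < c → ∀ᶠ r in 𝓝[>] (0:ℝ), r < c := fun c hc =>
    mem_nhdsWithin_of_mem_nhds (Iio_mem_nhds hc)
  have main : ∀ i ∈ Finset.Icc 1 N, ∀ᶠ r in 𝓝[>] (0:ℝ), 
      ∀ w ∈ BB z r, bakerMap^[p] w ∉ BB z r → bakerMap^[i] w ∉ BB z r := by
    intro i hi
    rw [Finset.mem_Icc] at hi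
    obtain ⟨ρ, hρ, hl⟩ := lin z hy i
    by_cases hd : p ∣ i
    · have hiz : bakerMap^[i] z = z := by
        obtain ⟨q, rfl⟩ := hd
        exact (Function.IsPeriodicPt.mul_const (show Function.IsPeriodicPt bakerMap p z from hper) q)
      have hpi : p ≤ i := Nat.le_of_dvd (by omega) hd
      filter_upwards [hev ρ hρ, hev ρp hρp] with r r1 r2 w hw hpw hiw
      obtain ⟨a1, a2⟩ := hw
      apply hpw
      obtain ⟨b1, b2⟩ := hiw
      rw [hl w (a2.trans r1), hiz] at b2
      rw [hlp w (a2.trans r2), hper]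
      simp only [add_sub_cancel_left] at b2
      refine ⟨?_, ?_⟩
      · simp only [add_sub_cancel_left]
        rw [abs_mul, abs_of_pos (by positivity : (0:ℝ) < (1/2)^p)]
        refine lt_of_le_of_lt ?_ a1
        exact mul_le_of_le_one_left (abs_nonneg _) (pow_le_one₀ (by norm_num) (by norm_num))
      · simp only [add_sub_cancel_left]
        refine lt_of_le_of_lt ?_ b2
        rw [abs_mul, abs_mul, abs_of_pos (by positivity : (0:ℝ) < 2^p),
          abs_of_pos (by positivity : (0:ℝ) < 2^i)]
        gcongr
        norm_num
    · have hne : bakerMap^[i] z ≠ z := by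
        intro hh
        have e : i % p + p * (i / p) = i := Nat.mod_add_div i p
        rw [← e, Function.iterate_add_apply] at hh
        have : bakerMap^[p * (i / p)] z = z :=
          (Function.IsPeriodicPt.mul_const (show Function.IsPeriodicPt bakerMap p z from hper) _)
        rw [this] at hh
        exact hmin (i % p) (Nat.one_le_iff_ne_zero.mpr fun h => hd (Nat.dvd_of_mod_eq_zero h))
          (Nat.mod_lt _ (by omega)) hh
      have hpos : 0 < dist (bakerMap^[i] z) z := dist_pos.mpr hne
      filter_upwards [hev ρ hρ, hev (dist (bakerMap^[i] z) z / (2^i + 1)) (by positivity)]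
        with r r1 r2 w hw hpw hiw
      obtain ⟨a1, a2⟩ := hw
      obtain ⟨b1, b2⟩ := hiw
      rw [hl w (a2.trans r1)] at b1 b2
      rw [lt_div_iff₀ (by positivity)] at r2
      have r0 : 0 < r := lt_of_le_of_lt (abs_nonneg _) a2
      have c1 : |(1/2)^i * (w.1 - z.1)| < 2^i * r := by
        rw [abs_mul, abs_of_pos (by positivity : (0:ℝ) < (1/2)^i)]
        have : (1/2:ℝ)^i ≤ 1 := pow_le_one₀ (by norm_num) (by norm_num)
        have : (1:ℝ) ≤ 2^i := one_le_pow₀ (by norm_num)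
        have := abs_nonneg (w.1 - z.1)
        nlinarith
      have c2 : |2^i * (w.2 - z.2)| < 2^i * r := by
        rw [abs_mul, abs_of_pos (by positivity : (0:ℝ) < 2^i)]
        gcongr
      dsimp only at b1 b2
      have : dist (bakerMap^[i] z) z < r * (2^i + 1) := by
        rw [Prod.dist_eq, Real.dist_eq, Real.dist_eq]
        rw [abs_lt] at *
        refine max_lt (abs_lt.mpr ⟨?_, ?_⟩) (abs_lt.mpr ⟨?_, ?_⟩) <;> linarith [c1.1, c1.2, c2.1, c2.2, b1.1, b1.2, b2.1, b2.2]
      linarith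
  have := (Finset.eventually_all (Finset.Icc 1 N)).mpr main
  filter_upwards [this] with r hr i h1 h2
  exact hr i (Finset.mem_Icc.mpr ⟨h1, h2⟩)

noncomputable def mm (n : ℕ) : ℕ := 3 * (Nat.log 2 n + 1)

lemma log_tend : Tendsto (fun n => Nat.log 2 n) atTop atTop := by
  refine tendsto_atTop_atTop.mpr fun b => ⟨2^b, fun n hn => ?_⟩
  exact Nat.le_log_of_pow_le (by norm_num) hn

lemma mm_half (n : ℕ) (hn : 1 ≤ n) : (1/2:ℝ)^(mm n) ≤ 1 / (n:ℝ)^3 := by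
  have h : n < 2^(Nat.log 2 n + 1) := Nat.lt_pow_succ_log_self (by norm_num) n
  have h2 : (n:ℝ) ≤ 2^(Nat.log 2 n + 1) := by exact_mod_cast h.le
  have hn' : (0:ℝ) < n := by exact_mod_cast hn
  rw [one_div, inv_pow, ← one_div]
  refine one_div_le_one_div_of_le (by positivity) ?_
  unfold mm
  rw [mul_comm 3, pow_mul]
  gcongr

lemma mm_tend : Tendsto (fun n => (mm n : ℝ)) atTop atTop := by
  refine tendsto_natCast_atTop_atTop.comp ?_
  refine tendsto_atTop_mono (fun n => ?_) log_tend
  unfold mm; omega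

lemma mm_sq : Tendsto (fun n : ℕ => (mm n : ℝ)^2 / √n) atTop (𝓝 0) := by
  have h1 : (1:ℝ) < √2 := by rw [Real.lt_sqrt] <;> norm_num
  have h := tendsto_pow_const_div_const_pow_of_one_lt 2 h1
  have h2 := (h.comp (tendsto_add_atTop_nat 1)).comp log_tend
  have h3 := h2.const_mul (9 * √2)
  rw [mul_zero] at h3
  refine squeeze_zero' (Eventually.of_forall fun n => by positivity) ?_ h3
  filter_upwards [eventually_ge_atTop 1] with n hn
  have a1 : 2^(Nat.log 2 n) ≤ n := Nat.pow_log_le_self 2 (by omega)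
  have a2 : (√2)^(Nat.log 2 n) ≤ √n := by
    refine Real.le_sqrt_of_sq_le ?_
    rw [← pow_mul, mul_comm, pow_mul, Real.sq_sqrt (by norm_num)]
    exact_mod_cast a1
  have p2 : (0:ℝ) < √2 := by linarith
  simp only [Function.comp]
  have e : 9 * √2 * (((Nat.log 2 n + 1 : ℕ) : ℝ)^2 / (√2)^(Nat.log 2 n + 1)) =
    (mm n : ℝ)^2 / (√2)^(Nat.log 2 n) := by
    unfold mm
    rw [pow_succ (√2)]
    push_cast
    field_simp
    ring
  rw [e]
  gcongr

lemma pow_lim (k : ℕ → ℕ) (q : ℕ → ℝ) (t : ℝ) (hq0 : ∀ n, 0 ≤ q n) (hq : Tendsto q atTop (𝓝 0))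
    (hk : Tendsto (fun n => k n * q n) atTop (𝓝 t)) :
    Tendsto (fun n => (1 - q n)^(k n)) atTop (𝓝 (Real.exp (-t))) := by
  have hev : ∀ᶠ n in atTop, q n < 1 := hq.eventually (gt_mem_nhds one_pos)
  have h1 : Tendsto (fun n => k n * Real.log (1 - q n)) atTop (𝓝 (-t)) := by
    have l1 : Tendsto (fun n => -(k n * q n) * (1 - q n)⁻¹) atTop (𝓝 (-t)) := by
      have := hk.neg.mul ((tendsto_const_nhds (x := (1:ℝ))).sub hq |>.inv₀ (by norm_num))
      simpa using this
    refine tendsto_of_tendsto_of_tendsto_of_le_of_le' l1 hk.neg ?_ ?_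
    · filter_upwards [hev] with n hn
      have hp : 0 < 1 - q n := by linarith
      have := Real.one_sub_inv_le_log_of_pos hp
      have e : -(k n * q n) * (1 - q n)⁻¹ = k n * (1 - (1 - q n)⁻¹) := by
        field_simp; ring
      rw [e]; gcongr
    · filter_upwards [hev] with n hn
      have hp : 0 < 1 - q n := by linarith
      have := Real.log_le_sub_one_of_pos hp
      rw [← mul_neg]
      gcongr; linarith
  refine ((Real.continuous_exp.tendsto _).comp h1).congr' ?_
  filter_upwards [hev] with n hn
  have hp : 0 < 1 - q n := by linarith
  simp only [Function.comp]
  rw [mul_comm, Real.exp_mul, Real.exp_log hp, Real.rpow_natCast]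

lemma mainlim (z : ℝ × ℝ) (hz : z ∈ Set.Ioo (0:ℝ) 1 ×ˢ Set.Ioo (0:ℝ) 1)
    (hy : Nondyadic z.2) (p : ℕ) (hp : 1 ≤ p)
    (hper : bakerMap^[p] z = z)
    (hmin : ∀ j, 1 ≤ j → j < p → bakerMap^[j] z ≠ z) (τ : ℝ) (hτ : 0 < τ) (r : ℕ → ℝ)
    (hr : Tendsto r atTop (𝓝[>] 0))
    (hb : Tendsto (fun n : ℕ => (n:ℝ) * mu.real (BB z (r n))) atTop (𝓝 τ)) :
    Tendsto (fun n => mu.real (WW z (r n) n)) atTop (𝓝 (Real.exp (-((1 - (1/2)^p) * τ)))) := by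
  have hr0 : ∀ᶠ n in atTop, 0 < r n := hr.eventually self_mem_nhdsWithin
  have hg := hr.eventually (geom z hz hy p hper)
  set b : ℕ → ℝ := fun n => mu.real (BB z (r n)) with hbdef
  have b0 : ∀ n, 0 ≤ b n := fun n => measureReal_nonneg
  let l : ℕ → ℕ := fun n => (mm n)^2
  let L : ℕ → ℕ := fun n => l n + 2 * mm n
  let k : ℕ → ℕ := fun n => n / L n
  have mpos : ∀ n, 1 ≤ mm n := fun n => by unfold mm; omega
  have kL : ∀ n, k n * L n ≤ n := fun n => Nat.div_mul_le_self _ _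
  have kL2 : ∀ n, n - k n * L n ≤ L n := fun n => by
    have h : L n * (n / L n) + n % L n = n := Nat.div_add_mod n (L n)
    have h2 : n % L n < L n := Nat.mod_lt _ (by have := mpos n; simp only [L]; omega)
    have : k n * L n = L n * (n / L n) := mul_comm _ _
    omega
  have sq0 : Tendsto (fun n : ℕ => (mm n : ℝ)^2 / n) atTop (𝓝 0) := by
    refine squeeze_zero' (Eventually.of_forall fun n => by positivity) ?_ mm_sq
    filter_upwards [eventually_ge_atTop 1] with n hn
    have h1 : (1:ℝ) ≤ n := by exact_mod_cast hn
    have : √n ≤ (n:ℝ) := Real.sqrt_le_self_iff.mpr (Or.inr h1)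
    gcongr
  have Lb : Tendsto (fun n => (L n : ℝ) * b n) atTop (𝓝 0) := by
    have h := (sq0.const_mul 3).mul hb
    simp only [mul_zero, zero_mul] at h
    refine squeeze_zero' (Eventually.of_forall fun n => by have := b0 n; positivity) ?_ h
    filter_upwards [eventually_ge_atTop 1] with n hn
    have hn' : (0:ℝ) < n := by exact_mod_cast hn
    have e : 3 * ((mm n : ℝ)^2 / n) * (n * b n) = 3 * (mm n : ℝ)^2 * b n := by
      field_simp
    rw [e]
    have h1 : (1:ℝ) ≤ mm n := by exact_mod_cast mpos n
    have := b0 n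
    simp only [L, l]; push_cast
    gcongr
    nlinarith
  have kmb : Tendsto (fun n => (k n : ℝ) * (mm n * b n)) atTop (𝓝 0) := by
    have h := hb.mul mm_tend.inv_tendsto_atTop
    rw [mul_zero] at h
    refine squeeze_zero' (Eventually.of_forall fun n => by have := b0 n; positivity) ?_ h
    refine Eventually.of_forall fun n => ?_
    have h0 : (0:ℝ) < mm n := by exact_mod_cast mpos n
    have h1 : (k n : ℝ) * (mm n * mm n) ≤ n := by
      have : k n * (mm n * mm n) ≤ n := by
        refine le_trans (Nat.mul_le_mul_left _ ?_) (kL n)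
        simp only [L, l]; nlinarith
      exact_mod_cast this
    simp only [Pi.inv_apply]
    rw [← div_eq_mul_inv, le_div_iff₀ h0]
    calc (k n : ℝ) * (mm n * b n) * mm n = (k n * (mm n * mm n)) * b n := by ring
      _ ≤ n * b n := mul_le_mul_of_nonneg_right h1 (b0 n)
  have kb : Tendsto (fun n => (k n : ℝ) * b n) atTop (𝓝 0) := by
    refine squeeze_zero' (Eventually.of_forall fun n => by have := b0 n; positivity) ?_ kmb
    refine Eventually.of_forall fun n => ?_
    have h1 : (1:ℝ) ≤ mm n := by exact_mod_cast mpos n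
    have := le_mul_of_one_le_left (b0 n) h1
    gcongr
  have rest : Tendsto (fun n => ((n - k n * L n : ℕ) : ℝ) * b n) atTop (𝓝 0) := by
    refine squeeze_zero' (Eventually.of_forall fun n => by have := b0 n; positivity) ?_ Lb
    refine Eventually.of_forall fun n => ?_
    exact mul_le_mul_of_nonneg_right (by exact_mod_cast kL2 n) (b0 n)
  have klb : Tendsto (fun n => (k n : ℝ) * (l n * b n)) atTop (𝓝 τ) := by
    have h := (hb.sub rest).sub (kmb.const_mul 2)
    simp only [mul_zero, sub_zero] at h
    refine h.congr fun n => ?_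
    rw [Nat.cast_sub (kL n)]
    simp only [L]; push_cast; ring
  have lr : Tendsto (fun n => r n * l n) atTop (𝓝 0) := by
    have h1 : Tendsto (fun n => √(n * b n / 4)) atTop (𝓝 (√(τ / 4))) :=
      (Real.continuous_sqrt.tendsto _).comp (hb.div_const 4)
    have h2 := mm_sq.mul h1
    rw [zero_mul] at h2
    refine h2.congr' ?_
    filter_upwards [hg, hr0, eventually_ge_atTop 1] with n hn hn0 hn1
    have hn' : (0:ℝ) < n := by exact_mod_cast hn1
    have e : (n:ℝ) * b n / 4 = n * (r n)^2 := by
      simp only [hbdef]; rw [hn.1]; ring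
    rw [e, Real.sqrt_mul hn'.le, Real.sqrt_sq hn0.le]
    have : √(n:ℝ) ≠ 0 := (Real.sqrt_pos.mpr hn').ne'
    simp only [l]; push_cast
    field_simp
  let q : ℕ → ℝ := fun n => 1 - mu.real (WW z (r n) (l n))
  have q0 : ∀ n, 0 ≤ q n := fun n => sub_nonneg.mpr measureReal_le_one
  set θ : ℝ := 1 - (1/2)^p with hθ
  have qup : ∀ᶠ n in atTop, q n ≤ l n * (θ * b n) + p * b n := by
    filter_upwards [hg] with n hn
    have := upper z (r n) p hp (l n)
    rw [hn.2, ← hn.1] at this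
    exact this
  have hθ1 : θ ≤ 1 := by
    have : (0:ℝ) ≤ (1/2)^p := by positivity
    rw [hθ]; linarith
  have qlim0 : Tendsto q atTop (𝓝 0) := by
    have h := Lb.mul_const (1 + (p:ℝ))
    rw [zero_mul] at h
    refine squeeze_zero' (Eventually.of_forall q0) ?_ h
    filter_upwards [qup] with n hn
    refine hn.trans ?_
    have hb' := b0 n
    have h1 : (1:ℝ) ≤ L n := by
      exact_mod_cast (by have := mpos n; simp only [L]; omega : 1 ≤ L n)
    have h2 : (l n:ℝ) ≤ L n := by
      exact_mod_cast (by simp only [L]; omega : l n ≤ L n)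
    have h3 : θ * b n ≤ b n := mul_le_of_le_one_left hb' hθ1
    calc (l n : ℝ) * (θ * b n) + p * b n ≤ L n * b n + p * (L n * b n) := by
          refine add_le_add ?_ ?_
          · exact (mul_le_mul_of_nonneg_left h3 (by positivity)).trans
              (mul_le_mul_of_nonneg_right h2 hb')
          · exact mul_le_mul_of_nonneg_left (le_mul_of_one_le_left hb' h1) (by positivity)
      _ = _ := by ring
  have kq : Tendsto (fun n => k n * q n) atTop (𝓝 (θ * τ)) := by
    rw [tendsto_order]
    constructor
    · intro c hc
      have hN : Tendsto (fun N : ℕ => θ * τ - (2 * (1/2:ℝ)^N) * τ) atTop (𝓝 (θ * τ)) := by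
        have := ((tendsto_pow_atTop_nhds_zero_of_lt_one (by norm_num : (0:ℝ) ≤ 1/2)
          (by norm_num)).const_mul 2).mul_const τ |>.const_sub (θ * τ)
        simpa using this
      obtain ⟨N, hN⟩ := (hN.eventually (lt_mem_nhds hc)).exists
      have h1 : Tendsto (fun n => θ * (k n * (l n * b n)) -
          (2 * (r n * l n) + 2 * (1/2:ℝ)^N) * (k n * (l n * b n))) atTop
          (𝓝 (θ * τ - (2 * 0 + 2 * (1/2:ℝ)^N) * τ)) :=
        (klb.const_mul θ).sub (((lr.const_mul 2).add_const _).mul klb)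
      rw [mul_zero, zero_add] at h1
      filter_upwards [h1.eventually (lt_mem_nhds hN), hg, hr0,
        hr.eventually (geom2 z hy p hp hper hmin N)] with n h1 h2 h3 h4
      refine lt_of_lt_of_le h1 ?_
      have h5 := lower z (r n) p N (l n) h3.le h4 (pair z (r n) h3.le)
      rw [h2.2, ← h2.1] at h5
      have h6 := mul_le_mul_of_nonneg_left h5 (Nat.cast_nonneg (α := ℝ) (k n))
      refine le_trans (le_of_eq ?_) h6
      simp only [hbdef]
      ring
    · intro c hc
      have h1 : Tendsto (fun n => θ * (k n * (l n * b n)) + p * (k n * b n)) atTop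
          (𝓝 (θ * τ + p * 0)) := (klb.const_mul θ).add (kb.const_mul _)
      rw [mul_zero, add_zero] at h1
      filter_upwards [h1.eventually (gt_mem_nhds hc), qup] with n h1 h2
      refine lt_of_le_of_lt ?_ h1
      have h6 := mul_le_mul_of_nonneg_left h2 (Nat.cast_nonneg (α := ℝ) (k n))
      refine h6.trans (le_of_eq ?_)
      ring
  have hpow := pow_lim k q _ q0 qlim0 kq
  have diff : Tendsto (fun n => mu.real (WW z (r n) n) - (1 - q n)^(k n)) atTop (𝓝 0) := by
    have h8 : Tendsto (fun n : ℕ => 8 / (n:ℝ)) atTop (𝓝 0) := tendsto_const_div_atTop_nhds_zero_nat 8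
    have h := (rest.add (kmb.const_mul 2)).add h8
    simp only [mul_zero, add_zero] at h
    refine squeeze_zero_norm' ?_ h
    filter_upwards [eventually_ge_atTop 1] with n hn
    have hn' : (0:ℝ) < n := by exact_mod_cast hn
    have t1 := tail_le z (r n) (k n * L n) (n - k n * L n)
    rw [Nat.add_sub_cancel' (kL n)] at t1
    have t2 := blocks z (r n) (l n) (mm n) n (k n) (kL n)
    have t3 := mm_half n hn
    have t4 : (k n : ℝ) * (8 * n * (1/2)^(mm n)) ≤ 8 / n := by
      have hk : (k n : ℝ) ≤ n := by exact_mod_cast Nat.div_le_self n (L n)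
      calc (k n : ℝ) * (8 * n * (1/2)^(mm n)) ≤ n * (8 * n * (1 / (n:ℝ)^3)) := by gcongr
        _ = 8 / n := by field_simp
    rw [Real.norm_eq_abs]
    have e : 1 - q n = mu.real (WW z (r n) (l n)) := by simp only [q]; ring
    rw [e]
    refine (abs_sub_le _ (mu.real (WW z (r n) (k n * L n))) _).trans ?_
    refine (add_le_add t1 t2).trans ?_
    simp only [hbdef] 
    linarith
  have := diff.add hpow
  simpa using this

lemma ball_BB (z : ℝ × ℝ) (r : ℝ) : Metric.ball z r = BB z r := by
  ext w
  rw [Metric.mem_ball, Prod.dist_eq, max_lt_iff, Real.dist_eq, Real.dist_eq]; rfl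

lemma lam_singleton (a : ℝ) : lam {a} = 0 := by
  unfold lam; exact measure_singleton a

lemma ae_ne (z : ℝ × ℝ) : ∀ᵐ w ∂mu, ∀ j, bakerMap^[j] w ≠ z := by
  rw [ae_all_iff]
  intro j
  have h : ∀ᵐ w ∂mu, w ≠ z := by
    rw [ae_iff]
    have : {a : ℝ × ℝ | ¬ a ≠ z} = {z.1} ×ˢ {z.2} := by ext ⟨a, b⟩; simp [Prod.ext_iff]
    rw [this, mu, Measure.prod_prod, lam_singleton, zero_mul]
  exact (mpi j).quasiMeasurePreserving.ae h

lemma set_eq (z : ℝ × ℝ) (u : ℝ) (n : ℕ) :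
    mu {x : ℝ × ℝ | ∀ j < n, -Real.log (dist (bakerMap^[j] x) z) ≤ u} =
      mu (WW z (Real.exp (-u)) n) := by
  refine measure_congr ?_
  filter_upwards [ae_ne z] with w hw
  refine propext ?_
  change (∀ j < n, -Real.log (dist (bakerMap^[j] w) z) ≤ u) ↔ ∀ j < n, bakerMap^[j] w ∉ BB z _
  refine forall₂_congr fun j _ => ?_
  rw [← ball_BB, Metric.mem_ball, not_lt, ← Real.le_log_iff_exp_le (dist_pos.mpr (hw j)), neg_le]

/-- Gumbel law with extremal index `θ = 1 - 2^{-p}` at a periodic point of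
minimal period `p` for the standard baker's map, computed in the `ℓ^∞`
metric: if `n · Leb(B_∞(z, e^{-u_n})) → τ`, then the Lebesgue measure of
`{x ∈ [0,1]² : max_{0 ≤ j < n} (-log d_∞(T^j x, z)) ≤ u_n}` tends to
`e^{-(1 - 2^{-p})τ}`. Here `dist` and `Metric.ball` on `ℝ × ℝ` are the
distance and open ball for the sup metric. -/
theorem stmt_14 (z : ℝ × ℝ) (hz : z ∈ Set.Ioo (0:ℝ) 1 ×ˢ Set.Ioo (0:ℝ) 1)
    (hx : Nondyadic z.1) (hy : Nondyadic z.2) (p : ℕ) (hp : 1 ≤ p)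
    (hper : bakerMap^[p] z = z)
    (hmin : ∀ j, 1 ≤ j → j < p → bakerMap^[j] z ≠ z) :
    ∀ τ : ℝ, 0 < τ → ∀ u : ℕ → ℝ,
      Tendsto (fun n : ℕ =>
          (n : ℝ) * ((volume.restrict unitSq) (Metric.ball z (Real.exp (-u n)))).toReal)
        atTop (𝓝 τ) →
      Tendsto (fun n : ℕ =>
          (volume.restrict unitSq)
            {x : ℝ × ℝ | ∀ j < n, -Real.log (dist (bakerMap^[j] x) z) ≤ u n})
        atTop (𝓝 (ENNReal.ofReal (Real.exp (-((1 - (2:ℝ) ^ (-(p:ℤ))) * τ))))) := by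
  intro τ hτ u hu
  rw [mu_eq] at hu ⊢
  simp only [set_eq]
  simp only [ball_BB] at hu
  change Tendsto (fun n : ℕ => (n : ℝ) * mu.real (BB z (Real.exp (-u n)))) atTop (𝓝 τ) at hu
  have hv : Tendsto (fun n : ℕ => mu.real (BB z (Real.exp (-u n)))) atTop (𝓝 0) := by
    have h := hu.mul (tendsto_inv_atTop_nhds_zero_nat (𝕜 := ℝ))
    rw [mul_zero] at h
    refine h.congr' ?_
    filter_upwards [eventually_ge_atTop 1] with n hn
    have hn' : (n : ℝ) ≠ 0 := by positivity
    field_simp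
  have hr : Tendsto (fun n => Real.exp (-u n)) atTop (𝓝[>] 0) := by
    refine tendsto_nhdsWithin_iff.mpr ⟨?_, Eventually.of_forall fun n => Real.exp_pos _⟩
    rw [tendsto_order]
    refine ⟨fun c hc => Eventually.of_forall fun n => hc.trans (Real.exp_pos _), fun ε hε => ?_⟩
    have h1 : ∀ᶠ s in 𝓝[>] (0:ℝ), s < ε := mem_nhdsWithin_of_mem_nhds (Iio_mem_nhds hε)
    obtain ⟨s, ⟨⟨hs1, _⟩, hs2⟩, hs3⟩ :=
      (((geom z hz hy p hper).and h1).and self_mem_nhdsWithin).exists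
    have hs3 : 0 < s := hs3
    filter_upwards [hv.eventually (gt_mem_nhds (by positivity : 0 < 4 * s^2))] with n hn
    refine lt_trans ?_ hs2
    by_contra hc
    rw [not_lt] at hc
    have : mu.real (BB z s) ≤ mu.real (BB z (Real.exp (-u n))) :=
      measureReal_mono fun w hw => ⟨lt_of_lt_of_le hw.1 hc, lt_of_lt_of_le hw.2 hc⟩
    linarith
  have hm := mainlim z hz hy p hp hper hmin τ hτ _ hr hu
  have h2 := (ENNReal.continuous_ofReal.tendsto _).comp hm
  have e : (2:ℝ) ^ (-(p:ℤ)) = (1/2)^p := by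
    rw [zpow_neg, zpow_natCast, one_div, inv_pow]
  rw [e]
  refine h2.congr fun n => ?_
  simp [Measure.real]
end
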